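/- arXiv:2604.10828 — 2 statements merged into one kernel-verified Lean document; each statement's English description precedes it below -/
import Mathlib

section
/- Let D_i, D_j, D_h, D_l be disks such that {D_i, D_j, D_h} and {D_i, D_j, D_l} are both strongly convex independent sets, with equidistant points v_ijh and v_ijl respectively (each equidistant in signed distance from the corresponding three disks), and both D_h and D_l appear between D_i and D_j in the same counterclockwise hull order of the full disk set. Suppose the centers of D_i and D_j lie on a common horizontal line. If the y-coordinate of v_ijh is less than the y-coordinate of v_ijl, then the signed distance from v_ijl to D_i is strictly less than the signed distance from v_ijl to D_h, i.e., |v_ijl p_i| - r_i < |v_ijl p_h| - r_h. -/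
open Metric Set
open scoped RealInnerProductSpace

noncomputable section

abbrev Pt : Type := EuclideanSpace ℝ (Fin 2)

/-- A closed disk in the plane, given by a center and a radius. -/
structure Disk : Type where
  center : Pt
  radius : ℝ

instance : DecidableEq Disk := Classical.decEq _

/-- The set of points of a disk (a closed ball). -/
def Disk.pts (D : Disk) : Set Pt := Metric.closedBall D.center D.radius

/-- The signed distance from a point `q` to a disk: `|q p| - r`. -/
def Disk.sd (D : Disk) (q : Pt) : ℝ := dist q D.center - D.radius

/-- Two disks are disjoint if the distance between their centers exceeds the sum of radii. -/
def Disk.Disj (D E : Disk) : Prop := D.radius + E.radius < dist D.center E.center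

/-- The union of the points of a set of disks. -/
def diskUnion (𝒟 : Set Disk) : Set Pt := ⋃ D ∈ 𝒟, D.pts

/-- The convex hull of a set of disks. -/
def diskHull (𝒟 : Set Disk) : Set Pt := convexHull ℝ (diskUnion 𝒟)

/-- The part of the boundary circle of `D` appearing on the boundary of the convex hull
of the disks of `𝒟`. -/
def hullArc (𝒟 : Set Disk) (D : Disk) : Set Pt :=
  Metric.sphere D.center D.radius ∩ frontier (diskHull 𝒟)

/-- Convex position: every disk's boundary contributes (at least) a point to the hull boundary. -/
def ConvexPos (𝒟 : Set Disk) : Prop := ∀ D ∈ 𝒟, (hullArc 𝒟 D).Nonempty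

/-- Strongly convex position: every disk's boundary contributes exactly one maximal (nonempty)
arc to the hull boundary, i.e. its trace on the hull boundary is nonempty and connected. -/
def StronglyConvexPos (𝒟 : Set Disk) : Prop := ∀ D ∈ 𝒟, IsConnected (hullArc 𝒟 D)

/-- An independent set of disks: pairwise disjoint. -/
def IndepSet (𝒟 : Set Disk) : Prop := ∀ A ∈ 𝒟, ∀ B ∈ 𝒟, A ≠ B → A.Disj B

/-- A strongly convex independent set. -/
def StronglyConvexIndep (𝒟 : Set Disk) : Prop := StronglyConvexPos 𝒟 ∧ IndepSet 𝒟

/-- Cross product (orientation test) of `a - o` and `b - o`. -/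
def cross (o a b : Pt) : ℝ := (a 0 - o 0) * (b 1 - o 1) - (a 1 - o 1) * (b 0 - o 0)

/-- `a, b, c` appear in strictly counterclockwise angular order around `o`. -/
def ccw3 (o a b c : Pt) : Prop := 0 < cross o a b ∧ 0 < cross o b c ∧ 0 < cross o c a

/-- `Dm` lies strictly between `Da` and `Db` in the counterclockwise order of the disks
along the boundary of the convex hull of `𝒟`. -/
def CCWBetween (𝒟 : Set Disk) (Da Dm Db : Disk) : Prop :=
  ∃ o ∈ interior (diskHull 𝒟), ∀ qa ∈ hullArc 𝒟 Da, ∀ qm ∈ hullArc 𝒟 Dm,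
    ∀ qb ∈ hullArc 𝒟 Db, ccw3 o qa qm qb

/-- A point regarded as a radius-zero disk. -/
def pointDisk (p : Pt) : Disk := ⟨p, 0⟩

/-- `m` is the midpoint of the circular arc `A` of a circle centered at `c`: some nonidentity
isometric involution of the plane (a reflection) fixes `c` and `m` and maps `A` onto itself. -/
def IsArcMidpoint (c : Pt) (A : Set Pt) (m : Pt) : Prop :=
  m ∈ A ∧ ∃ f : Pt ≃ᵢ Pt, f c = c ∧ f m = m ∧ (∀ x, f (f x) = x) ∧
    f ≠ IsometryEquiv.refl Pt ∧ f '' A = A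


lemma dist_sq' (x y : Pt) : dist x y ^ 2 = (x 0 - y 0)^2 + (x 1 - y 1)^2 := by
  rw [EuclideanSpace.dist_eq, Real.sq_sqrt (by positivity)]
  simp [Fin.sum_univ_two, Real.dist_eq, sq_abs]

/-- supporting line -/
lemma exists_support (C : Set Pt) (hC : Convex ℝ C) (hne : (interior C).Nonempty) (x : Pt)
    (hx : x ∉ interior C) :
    ∃ a b : ℝ, a^2 + b^2 = 1 ∧ ∀ z ∈ C, a * z 0 + b * z 1 ≤ a * x 0 + b * x 1 := by
  obtain ⟨f, hf⟩ := geometric_hahn_banach_open_point hC.interior isOpen_interior hx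
  have hle : ∀ z ∈ C, f z ≤ f x := by
    intro z hz
    have h1 : z ∈ closure (interior C) := by
      rw [hC.closure_interior_eq_closure_of_nonempty_interior hne]
      exact subset_closure hz
    have h2 : closure (interior C) ⊆ {z | f z ≤ f x} :=
      closure_minimal (fun z hz => (hf z hz).le) (isClosed_le f.continuous continuous_const)
    exact h2 h1
  set A := f (EuclideanSpace.single 0 1) with hA
  set B := f (EuclideanSpace.single 1 1) with hB
  have hrep : ∀ z : Pt, f z = A * z 0 + B * z 1 := by
    intro z
    have : z = z 0 • EuclideanSpace.single 0 (1:ℝ) + z 1 • EuclideanSpace.single 1 (1:ℝ) := by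
      ext i; fin_cases i <;> simp
    conv_lhs => rw [this]
    simp only [map_add, map_smul, smul_eq_mul]
    rw [← hA, ← hB]; ring
  have hpos : 0 < A^2 + B^2 := by
    by_contra hcon
    have hA0 : A = 0 := by nlinarith [sq_nonneg A, sq_nonneg B]
    have hB0 : B = 0 := by nlinarith [sq_nonneg A, sq_nonneg B]
    obtain ⟨o, ho⟩ := hne
    have := hf o ho
    rw [hrep, hrep, hA0, hB0] at this
    linarith
  set n := Real.sqrt (A^2 + B^2) with hn
  have hnpos : 0 < n := Real.sqrt_pos.2 hpos
  have hn2 : n^2 = A^2 + B^2 := Real.sq_sqrt hpos.le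
  refine ⟨A / n, B / n, ?_, ?_⟩
  · rw [div_pow, div_pow, ← add_div, hn2, div_self hpos.ne']
  · intro z hz
    have := hle z hz
    rw [hrep, hrep] at this
    have e : ∀ z : Pt, A / n * z 0 + B / n * z 1 = (A * z 0 + B * z 1) / n := by
      intro z; ring
    rw [e, e]
    gcongr

lemma not_mem_interior_of_support (C : Set Pt) (x : Pt) (a b : ℝ) (hab : a^2 + b^2 = 1)
    (h : ∀ z ∈ C, a * z 0 + b * z 1 ≤ a * x 0 + b * x 1) : x ∉ interior C := by
  intro hx
  have hcont : Filter.Tendsto (fun t : ℝ => x + t • (!₂[a, b] : Pt)) (nhdsWithin 0 (Ioi 0)) (nhds x) := by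
    have : Continuous (fun t : ℝ => x + t • (!₂[a, b] : Pt)) := by fun_prop
    have h2 := this.tendsto 0
    simp only [zero_smul, add_zero] at h2
    exact h2.mono_left nhdsWithin_le_nhds
  have h1 := hcont.eventually (mem_interior_iff_mem_nhds.1 hx)
  obtain ⟨t, ht, ht0⟩ := (h1.and self_mem_nhdsWithin).exists
  have h3 := h _ ht
  have ht0' : (0:ℝ) < t := ht0
  simp at h3
  nlinarith

lemma cross_cont (p q : Pt) : Continuous (fun z : Pt => cross p q z) := by
  unfold cross; fun_prop

lemma interior_of_tri (C : Set Pt) (hC : Convex ℝ C) (a b c : Pt) (ha : a ∈ C) (hb : b ∈ C)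
    (hc : c ∈ C) (h : 0 < cross a b c) : (interior C).Nonempty := by
  set U : Set Pt := {z | 0 < cross a b z} ∩ ({z | 0 < cross b c z} ∩ {z | 0 < cross c a z}) with hU
  have hUo : IsOpen U := by
    refine IsOpen.inter ?_ (IsOpen.inter ?_ ?_) <;>
    exact isOpen_lt continuous_const (cross_cont _ _)
  have hUC : U ⊆ C := by
    rintro z ⟨h1, h2, h3⟩
    simp only [mem_ofPred_eq] at h1 h2 h3
    set k := cross a b c with hk
    have hsum : cross b c z / k + cross c a z / k + cross a b z / k = 1 := by
      rw [← add_div, ← add_div, div_eq_one_iff_eq h.ne', hk]; unfold cross; ring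
    have hz : z = (cross b c z / k) • a + (cross c a z / k) • b + (cross a b z / k) • c := by
      have hk0 : k ≠ 0 := h.ne'
      ext i; fin_cases i <;> simp <;> field_simp <;> rw [hk] <;> unfold cross <;> ring
    rw [hz]
    have := hC.sum_mem (t := Finset.univ) (w := ![cross b c z / k, cross c a z / k, cross a b z / k])
      (z := ![a, b, c]) (by intro i _; fin_cases i <;> simp <;> positivity)
      (by simp [Fin.sum_univ_three]; linarith) (by intro i _; fin_cases i <;> simp [*])
    simpa [Fin.sum_univ_three] using this
  refine ⟨(1/3:ℝ) • a + (1/3:ℝ) • b + (1/3:ℝ) • c, interior_maximal hUC hUo ⟨?_, ?_, ?_⟩⟩ <;>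
  · simp only [mem_ofPred_eq]
    unfold cross at h ⊢
    simp
    nlinarith

lemma cross_no_sep (C : Set Pt) (hC : Convex ℝ C) (hne : (interior C).Nonempty) (A : Set Pt)
    (hA : IsConnected A) (hAC : ∀ z ∈ A, z ∈ C ∧ z ∉ interior C) (p q x y : Pt)
    (hp : p ∈ C) (hp' : p ∉ interior C) (hq : q ∈ C) (hq' : q ∉ interior C)
    (hpA : p ∉ A) (hqA : q ∉ A) (hpq : p ≠ q) (hx : x ∈ A) (hy : y ∈ A)
    (hcx : cross p q x < 0) : cross p q y ≤ 0 := by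
  by_contra! hcy
  obtain ⟨z, hz, hz0⟩ := hA.isPreconnected.intermediate_value hx hy
    (cross_cont p q).continuousOn ⟨hcx.le, hcy.le⟩
  simp only at hz0
  -- direct support at a middle point
  have key : ∀ m : Pt, m ∉ interior C → ∀ s t : Pt, s ∈ C → t ∈ C →
      ∀ k l : ℝ, 0 < k → 0 < l →
      (∀ i, s i - m i = k * (q i - p i)) → (∀ i, t i - m i = - (l * (q i - p i))) →
      cross p q m = 0 → False := by
    intro m hm s t hs ht k l hk hl hs' ht' hm0
    obtain ⟨a, b, hab, hsup⟩ := exists_support C hC hne m hm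
    have e1 := hsup s hs
    have e2 := hsup t ht
    have e3 := hsup x (hAC x hx).1
    have e4 := hsup y (hAC y hy).1
    have f1 : a * (q 0 - p 0) + b * (q 1 - p 1) ≤ 0 := by
      by_contra! hh
      have := mul_pos hk hh
      have h9 : a * (s 0 - m 0) + b * (s 1 - m 1) = k * (a * (q 0 - p 0) + b * (q 1 - p 1)) := by
        rw [hs' 0, hs' 1]; ring
      linarith
    have f2 : 0 ≤ a * (q 0 - p 0) + b * (q 1 - p 1) := by
      by_contra! hh
      have := mul_neg_of_pos_of_neg hl hh
      have h9 : a * (t 0 - m 0) + b * (t 1 - m 1) = -(l * (a * (q 0 - p 0) + b * (q 1 - p 1))) := by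
        rw [ht' 0, ht' 1]; ring
      linarith
    have f3 : a * (q 0 - p 0) + b * (q 1 - p 1) = 0 := le_antisymm f1 f2
    -- w = q - p = lam * (-b, a)
    set lam := a * (q 1 - p 1) - b * (q 0 - p 0) with hlam
    have g0 : q 0 - p 0 = - (lam * b) := by rw [hlam]; linear_combination (-(q 0 - p 0)) * hab + a * f3
    have g1 : q 1 - p 1 = lam * a := by rw [hlam]; linear_combination (-(q 1 - p 1)) * hab + b * f3
    unfold cross at hcx hcy hm0
    rw [g0, g1] at hcx hcy hm0
    have c1 : lam * ((a * m 0 + b * m 1) - (a * x 0 + b * x 1)) < 0 := by nlinarith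
    have c2 : 0 < lam * ((a * m 0 + b * m 1) - (a * y 0 + b * y 1)) := by nlinarith
    have l1 : lam < 0 := by
      by_contra! hh
      have := mul_nonneg hh (sub_nonneg.2 e3)
      linarith
    have := mul_nonneg_of_nonpos_of_nonpos l1.le (sub_nonpos.2 e4)
    have := mul_nonneg (neg_nonneg.2 l1.le) (sub_nonneg.2 e4)
    linarith
  have hzC := hAC z hz
  -- z = p + t (q-p)
  set N := (q 0 - p 0)^2 + (q 1 - p 1)^2 with hN
  have hNpos : 0 < N := by
    have : 0 < dist p q := dist_pos.2 hpq
    have h2 := dist_sq' p q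
    have : 0 < dist p q ^ 2 := by positivity
    rw [hN]; nlinarith
  set t := ((z 0 - p 0) * (q 0 - p 0) + (z 1 - p 1) * (q 1 - p 1)) / N with ht
  have htN : t * N = (z 0 - p 0) * (q 0 - p 0) + (z 1 - p 1) * (q 1 - p 1) := by
    rw [ht]; field_simp
  have hz0' : (q 0 - p 0) * (z 1 - p 1) - (q 1 - p 1) * (z 0 - p 0) = 0 := hz0
  have z0 : z 0 - p 0 = t * (q 0 - p 0) := by
    have : N * (z 0 - p 0 - t * (q 0 - p 0)) = 0 := by
      rw [show N * (z 0 - p 0 - t * (q 0 - p 0)) = N * (z 0 - p 0) - (t * N) * (q 0 - p 0) by ring, htN, hN]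
      linear_combination (-(q 1 - p 1)) * hz0'
    have := (mul_eq_zero.1 this).resolve_left hNpos.ne'
    linarith
  have z1 : z 1 - p 1 = t * (q 1 - p 1) := by
    have : N * (z 1 - p 1 - t * (q 1 - p 1)) = 0 := by
      rw [show N * (z 1 - p 1 - t * (q 1 - p 1)) = N * (z 1 - p 1) - (t * N) * (q 1 - p 1) by ring, htN, hN]
      linear_combination (q 0 - p 0) * hz0'
    have := (mul_eq_zero.1 this).resolve_left hNpos.ne'
    linarith
  have hzi : ∀ i, z i - p i = t * (q i - p i) := by intro i; fin_cases i <;> assumption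
  have ht0 : t ≠ 0 := by
    intro h0
    apply hpA
    have : z = p := by ext i; have := hzi i; rw [h0] at this; linarith
    rwa [← this]
  have ht1 : t ≠ 1 := by
    intro h0
    apply hqA
    have : z = q := by ext i; have := hzi i; rw [h0] at this; linarith
    rwa [← this]
  have cpp : cross p q p = 0 := by unfold cross; ring
  have cqq : cross p q q = 0 := by unfold cross; ring
  rcases lt_or_gt_of_ne ht0 with h | h
  · exact key p hp' q z hq hzC.1 1 (-t) one_pos (by linarith) (by intro i; ring)
      (by intro i; rw [hzi]; ring) cpp
  · rcases lt_or_gt_of_ne ht1 with h' | h'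
    · refine key z hzC.2 q p hq hp (1 - t) t (by linarith) h ?_ ?_ hz0
      · intro i; have := hzi i; linarith
      · intro i; have := hzi i; linarith
    · refine key q hq' z p hzC.1 hp (t - 1) 1 (by linarith) one_pos ?_ ?_ cqq
      · intro i; have := hzi i; linarith
      · intro i; ring

lemma caseA1 (w0 w1 s0 s1 g0 g1 e0 e1 c d : ℝ) (hw : 0 < w0) (hg : 0 < g0 * w1 - g1 * w0)
    (hs : w0 * s1 - w1 * s0 ≤ 0) (hus : 0 < c * s0 + d * s1)
    (hes : e0 * s0 + e1 * s1 ≤ 0) (hew : e0 * w0 + e1 * w1 ≤ 0) (heg : e0 * g0 + e1 * g1 ≤ 0)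
    (he : e0^2 + e1^2 = 1) (hc : c^2 + d^2 = 1) (hd : 0 < d) (hec : e0 ≤ c)
    (huw : c * w0 + d * w1 < 0) : False := by
  obtain ⟨x, hx⟩ : ∃ x, s0 = x * w0 := ⟨s0 / w0, by field_simp⟩
  obtain ⟨y, hy⟩ : ∃ y, s1 = x * w1 - y := ⟨x * w1 - s1, by ring⟩
  obtain ⟨z, hz⟩ : ∃ x, g0 = x * w0 := ⟨g0 / w0, by field_simp⟩
  obtain ⟨k, hk⟩ : ∃ y, g1 = z * w1 - y := ⟨z * w1 - g1, by ring⟩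
  subst hx hy hz hk
  have hy0 : 0 ≤ y := by
    by_contra! h
    have := mul_neg_of_pos_of_neg hw h
    nlinarith
  have hk0 : 0 < k := by
    by_contra! h
    have := mul_nonpos_of_nonneg_of_nonpos hw.le h
    nlinarith
  set E := e0 * w0 + e1 * w1 with hE
  set W := c * w0 + d * w1 with hW
  have h1 : 0 < x * W - y * d := by rw [hW]; linarith
  have h2 : x * E - y * e1 ≤ 0 := by rw [hE]; linarith
  have h3 : z * E - k * e1 ≤ 0 := by rw [hE]; linarith
  have hx0 : x < 0 := by
    by_contra! h
    have := mul_nonneg hy0 hd.le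
    have := mul_nonpos_of_nonneg_of_nonpos h huw.le
    linarith
  have hxE : 0 ≤ x * E := mul_nonneg_of_nonpos_of_nonpos hx0.le hew
  have he1 : 0 ≤ e1 := by
    rcases hy0.eq_or_lt with h | h
    · rw [← h] at h2
      have : x * E = 0 := by linarith
      have hE0 : E = 0 := (mul_eq_zero.1 this).resolve_left hx0.ne
      rw [hE0] at h3
      by_contra! h
      have := mul_neg_of_pos_of_neg hk0 h
      linarith
    · by_contra! h'
      have := mul_neg_of_pos_of_neg h h'
      linarith
  have he1' : 0 < e1 := by
    rcases he1.eq_or_lt with h | h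
    · exfalso
      rw [← h] at h2
      have : x * E = 0 := by linarith
      have hE0 : E = 0 := (mul_eq_zero.1 this).resolve_left hx0.ne
      rw [hE, ← h] at hE0
      have : e0 * w0 = 0 := by linarith
      have : e0 = 0 := (mul_eq_zero.1 this).resolve_right hw.ne'
      rw [this, ← h] at he
      norm_num at he
    · exact h
  have h4 : x * (E * d) < x * (W * e1) := by
    have a1 : (x * E) * d ≤ (y * e1) * d := mul_le_mul_of_nonneg_right (by linarith) hd.le
    have a2 : (y * d) * e1 < (x * W) * e1 := mul_lt_mul_of_pos_right (by linarith) he1'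
    linarith
  have h5 : W * e1 < E * d := lt_of_not_ge fun hh => absurd (mul_le_mul_of_nonpos_left hh hx0.le) (not_le.2 h4)
  have h6 : w0 * (c * e1) < w0 * (e0 * d) := by rw [hE, hW] at h5; linarith
  have h7 : c * e1 < e0 * d := lt_of_mul_lt_mul_left h6 hw.le
  rcases le_or_gt e0 0 with h | h
  · have c0 : c < 0 := by
      by_contra! h'
      have := mul_nonneg h' he1
      have := mul_nonpos_of_nonpos_of_nonneg h hd.le
      linarith
    have : d < e1 := by
      by_contra! h'
      nlinarith
    nlinarith
  · have : e1 < d := by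
      by_contra! h'
      nlinarith
    nlinarith

lemma caseA (w0 w1 s0 s1 g0 g1 e0 e1 f0 f1 c d : ℝ) (hw : 0 < w0) (hg : 0 < g0 * w1 - g1 * w0)
    (hs : w0 * s1 - w1 * s0 ≤ 0) (hus : 0 < c * s0 + d * s1)
    (husw : 0 < c * (s0 - w0) + d * (s1 - w1))
    (hes : e0 * s0 + e1 * s1 ≤ 0) (hew : e0 * w0 + e1 * w1 ≤ 0) (heg : e0 * g0 + e1 * g1 ≤ 0)
    (hfs : f0 * (s0 - w0) + f1 * (s1 - w1) ≤ 0) (hfw : f0 * (-w0) + f1 * (-w1) ≤ 0)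
    (hfg : f0 * (g0 - w0) + f1 * (g1 - w1) ≤ 0)
    (he : e0^2 + e1^2 = 1) (hf : f0^2 + f1^2 = 1) (hc : c^2 + d^2 = 1) (hd : 0 < d)
    (hec : e0 ≤ c) (hfc : c ≤ f0) : False := by
  rcases lt_trichotomy (c * w0 + d * w1) 0 with h | h | h
  · exact caseA1 w0 w1 s0 s1 g0 g1 e0 e1 c d hw hg hs hus hes hew heg he hc hd hec h
  · have : w0 * (c * s0 + d * s1) ≤ 0 := by
      have : w0 * (c * s0 + d * s1) = (c * w0 + d * w1) * s0 + d * (w0 * s1 - w1 * s0) := by ring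
      rw [this, h]
      nlinarith
    nlinarith
  · exact caseA1 w0 (-w1) (-(s0 - w0)) (s1 - w1) (-(g0 - w0)) (g1 - w1) (-f0) f1 (-c) d hw
      (by linarith) (by linarith) (by linarith) (by linarith) (by linarith) (by linarith)
      (by linarith) (by linarith) hd (by linarith) (by linarith)

lemma caseB1 (γ ε A B m S R : ℝ) (hγ : 0 < γ) (hε : 0 ≤ ε) (hs : γ + ε ≤ 1) (hA : A < m)
    (hm : 0 ≤ m) (h : m < γ * A + ε * B) (h0 : 0 ≤ γ * S + ε * R) (hS : S ≤ γ * S + ε * R)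
    (hR : R ≤ γ * S + ε * R) (hne : S = 0 → R = 0 → False) (h1 : γ + ε ≠ 1) : False := by
  have hε' : 0 < ε := by
    rcases hε.eq_or_lt with h' | h'
    · rw [← h'] at h hs
      exfalso
      nlinarith
    · exact h'
  have hlt : γ + ε < 1 := lt_of_le_of_ne hs h1
  have hS0 : S ≤ 0 := by
    by_contra! hh
    rcases le_total S R with h' | h' <;> nlinarith
  have hR0 : R ≤ 0 := by
    by_contra! hh
    rcases le_total S R with h' | h' <;> nlinarith
  have a1 := mul_nonpos_of_nonneg_of_nonpos hγ.le hS0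
  have a2 := mul_nonpos_of_nonneg_of_nonpos hε hR0
  refine hne ?_ ?_
  · have : γ * S = 0 := by linarith
    exact (mul_eq_zero.1 this).resolve_left hγ.ne'
  · have : ε * R = 0 := by linarith
    exact (mul_eq_zero.1 this).resolve_left hε'.ne'

lemma caseB (a0 a1 b0 b1 x0 x1 y0 y1 n0 n1 H m e0 e1 f0 f1 g0 g1 : ℝ)
    (hκ : 0 < a0 * b1 - a1 * b0) (hH : 0 < H) (hna : n0 * a0 + n1 * a1 = H)
    (hnb : n0 * b0 + n1 * b1 = H) (hnx : n0 * x0 + n1 * x1 ≤ H) (hny : n0 * y0 + n1 * y1 ≤ H)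
    (hx : n0 * x0 + n1 * x1 = H → x0 = a0 ∧ x1 = a1)
    (hy : n0 * y0 + n1 * y1 = H → y0 = b0 ∧ y1 = b1)
    (hα : b0 * x1 - b1 * x0 ≤ 0) (hε : -(a0 * y1 - a1 * y0) ≤ 0)
    (hK : 0 < y0 * x1 - y1 * x0)
    (ma : a0 < m) (mx : x0 < m) (mb : m < b0) (my : m < y0)
    (hg : g0^2 + g1^2 = 1) (ga : g0 * a0 + g1 * a1 ≤ 0) (gb : g0 * b0 + g1 * b1 ≤ 0)
    (gx : g0 * x0 + g1 * x1 ≤ 0) (gy : g0 * y0 + g1 * y1 ≤ 0)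
    (he : e0^2 + e1^2 = 1) (e00 : 0 ≤ e0 * x0 + e1 * x1)
    (ea : e0 * a0 + e1 * a1 ≤ e0 * x0 + e1 * x1) (eb : e0 * b0 + e1 * b1 ≤ e0 * x0 + e1 * x1)
    (hf : f0^2 + f1^2 = 1) (f00 : 0 ≤ f0 * y0 + f1 * y1)
    (fa : f0 * a0 + f1 * a1 ≤ f0 * y0 + f1 * y1) (fb : f0 * b0 + f1 * b1 ≤ f0 * y0 + f1 * y1) :
    False := by
  set κ := a0 * b1 - a1 * b0 with hκd
  have hκ0 := hκ.ne'
  obtain ⟨α, hαd⟩ : ∃ α, α * κ = x0 * b1 - x1 * b0 := ⟨(x0 * b1 - x1 * b0) / κ, by field_simp⟩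
  obtain ⟨β, hβd⟩ : ∃ α, α * κ = a0 * x1 - a1 * x0 := ⟨(a0 * x1 - a1 * x0) / κ, by field_simp⟩
  obtain ⟨γ, hγd⟩ : ∃ α, α * κ = y0 * b1 - y1 * b0 := ⟨(y0 * b1 - y1 * b0) / κ, by field_simp⟩
  obtain ⟨ε, hεd⟩ : ∃ α, α * κ = a0 * y1 - a1 * y0 := ⟨(a0 * y1 - a1 * y0) / κ, by field_simp⟩
  have canc : ∀ s t : ℝ, κ * s = κ * t → s = t := fun s t h => mul_left_cancel₀ hκ0 h
  have X0 : x0 = α * a0 + β * b0 := canc _ _ (by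
    linear_combination x0 * hκd - a0 * hαd - b0 * hβd)
  have X1 : x1 = α * a1 + β * b1 := canc _ _ (by
    linear_combination x1 * hκd - a1 * hαd - b1 * hβd)
  have Y0 : y0 = γ * a0 + ε * b0 := canc _ _ (by
    linear_combination y0 * hκd - a0 * hγd - b0 * hεd)
  have Y1 : y1 = γ * a1 + ε * b1 := canc _ _ (by
    linear_combination y1 * hκd - a1 * hγd - b1 * hεd)
  have α0 : 0 ≤ α := by
    by_contra! h
    have := mul_neg_of_neg_of_pos h hκ
    linarith
  have ε0 : 0 ≤ ε := by
    by_contra! h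
    have := mul_neg_of_neg_of_pos h hκ
    linarith
  have hK' : α * ε < β * γ := by
    have : 0 < (β * γ - α * ε) * κ := by
      have e : (β * γ - α * ε) * κ = y0 * x1 - y1 * x0 := by rw [X0, X1, Y0, Y1, hκd]; ring
      rw [e]; exact hK
    by_contra! h
    have := mul_nonpos_of_nonpos_of_nonneg (sub_nonpos.2 h) hκ.le
    linarith
  have nx : n0 * x0 + n1 * x1 = (α + β) * H := by
    rw [X0, X1]; linear_combination α * hna + β * hnb
  have ny : n0 * y0 + n1 * y1 = (γ + ε) * H := by
    rw [Y0, Y1]; linear_combination γ * hna + ε * hnb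
  have sx : α + β ≤ 1 := by
    by_contra! h
    have := mul_lt_mul_of_pos_right h hH
    linarith
  have sy : γ + ε ≤ 1 := by
    by_contra! h
    have := mul_lt_mul_of_pos_right h hH
    linarith
  have dotx : ∀ p q : ℝ, p * x0 + q * x1 = α * (p * a0 + q * a1) + β * (p * b0 + q * b1) := by
    intro p q; rw [X0, X1]; ring
  have doty : ∀ p q : ℝ, p * y0 + q * y1 = γ * (p * a0 + q * a1) + ε * (p * b0 + q * b1) := by
    intro p q; rw [Y0, Y1]; ring
  have nz : ∀ p q : ℝ, p^2 + q^2 = 1 → p * a0 + q * a1 = 0 → p * b0 + q * b1 = 0 → False := by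
    intro p q h1 h2 h3
    have p0 : κ * p = κ * 0 := by rw [hκd]; linear_combination b1 * h2 - a1 * h3
    have q0 : κ * q = κ * 0 := by rw [hκd]; linear_combination a0 * h3 - b0 * h2
    rw [canc _ _ p0, canc _ _ q0] at h1
    norm_num at h1
  have hαε := mul_nonneg α0 ε0
  rcases lt_trichotomy γ 0 with hγ | hγ | hγ
  · have hβ : β < 0 := by
      by_contra! h
      have := mul_nonpos_of_nonneg_of_nonpos h hγ.le
      linarith
    rw [dotx] at gx
    rw [doty] at gy
    set S := g0 * a0 + g1 * a1 with hS
    set R := g0 * b0 + g1 * b1 with hR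
    -- αS + βR ≤ 0, γS+εR ≤ 0, S,R ≤ 0
    have t1 : R = 0 → S = 0 := by
      intro h
      rw [h] at gy
      by_contra h'
      have : S < 0 := lt_of_le_of_ne ga h'
      have := mul_pos_of_neg_of_neg hγ this
      linarith
    have t2 : S = 0 → R = 0 := by
      intro h
      rw [h] at gx
      by_contra h'
      have : R < 0 := lt_of_le_of_ne gb h'
      have := mul_pos_of_neg_of_neg hβ this
      linarith
    rcases ga.eq_or_lt with h | h
    · exact nz g0 g1 hg h (t2 h)
    rcases gb.eq_or_lt with h' | h'
    · exact nz g0 g1 hg (t1 h') h'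
    have q1 : β * R ≤ α * (-S) := by linarith
    have q2 : γ * S ≤ ε * (-R) := by linarith
    have q3 : (β * R) * (γ * S) ≤ (α * (-S)) * (ε * (-R)) :=
      mul_le_mul q1 q2 (mul_pos_of_neg_of_neg hγ h).le (mul_nonneg α0 (by linarith))
    have q4 : 0 < S * R := mul_pos_of_neg_of_neg h h'
    have q5 := mul_lt_mul_of_pos_right hK' q4
    linarith
  · rw [hγ] at hK'; linarith
  · have hβ : 0 < β := by
      by_contra! h
      have := mul_nonpos_of_nonpos_of_nonneg h hγ.le
      linarith
    rcases le_total 0 m with hm | hm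
    · refine caseB1 γ ε a0 b0 m (f0 * a0 + f1 * a1) (f0 * b0 + f1 * b1) hγ ε0 sy ma hm
        (by rw [← Y0]; exact my) (by rw [← doty]; exact f00) (by rw [← doty]; exact fa)
        (by rw [← doty]; exact fb) (nz f0 f1 hf) ?_
      intro h1
      rw [h1, one_mul] at ny
      obtain ⟨r0, r1⟩ := hy ny
      have : γ * κ = 0 := by rw [hγd, r0, r1]; ring
      have := mul_pos hγ hκ
      linarith
    · refine caseB1 β α (-b0) (-a0) (-m) (e0 * b0 + e1 * b1) (e0 * a0 + e1 * a1) hβ α0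
        (by linarith) (by linarith) (by linarith) (by linarith)
        (by have := dotx e0 e1; linarith) (by have := dotx e0 e1; linarith)
        (by have := dotx e0 e1; linarith) (fun h h' => nz e0 e1 he h' h) ?_
      intro h1
      rw [add_comm β, ] at h1
      rw [h1, one_mul] at nx
      obtain ⟨r0, r1⟩ := hx nx
      have : β * κ = 0 := by rw [hβd, r0, r1]; ring
      have := mul_pos hβ hκ
      linarith

set_option maxHeartbeats 1000000 in
/-- the final computation -/
lemma final_alg (v0 v1 w0 w1 i0 i1 Δ h0 h1 ri rh c d s s' : ℝ) (hΔ : 0 < Δ) (hd : 0 < d)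
    (hcd : c^2 + d^2 = 1)
    (vi : (v0 - i0)^2 + (v1 - i1)^2 = (ri + s)^2) (vi0 : 0 ≤ ri + s)
    (vj : (v0 - (i0 + Δ))^2 + (v1 - i1)^2 = (ri - c * Δ + s)^2)
    (vh : (v0 - h0)^2 + (v1 - h1)^2 = (rh + s)^2)
    (wi : (w0 - i0)^2 + (w1 - i1)^2 = (ri + s')^2) (wi0 : 0 ≤ ri + s')
    (wj : (w0 - (i0 + Δ))^2 + (w1 - i1)^2 = (ri - c * Δ + s')^2)
    (wh : (w0 - h0)^2 + (w1 - h1)^2 ≤ (rh + s')^2)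
    (hlt : v1 < w1)
    (ha : c * (h0 - i0) + d * (h1 - i1) + (rh - ri) ≤ 0)
    (hb : 0 ≤ c * (h0 - i0) - d * (h1 - i1) + (rh - ri)) :
    h1 = i1 ∧ (h0 = i0 ∧ rh = ri ∨ h0 = i0 + Δ ∧ rh = ri - c * Δ) := by
  set x := w0 - v0 with hx
  set y := w1 - v1 with hy
  set σ := s' - s with hσ
  have hw0 : w0 = v0 + x := by rw [hx]; ring
  have hw1 : w1 = v1 + y := by rw [hy]; ring
  have hs' : s' = s + σ := by rw [hσ]; ring
  clear_value x y σ
  subst hw0 hw1 hs'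
  have hy0 : 0 < y := by linarith
  have xe : x = c * σ := by
    have : Δ * (x - c * σ) = 0 := by linear_combination (wi - wj - vi + vj) / 2
    have := (mul_eq_zero.1 this).resolve_left hΔ.ne'
    linarith
  subst xe
  -- spacelike
  set p := v0 - i0 with hp
  set q := v1 - i1 with hq
  set ρ := ri + s with hρ
  have k1 : 2 * ρ * σ + σ^2 = 2 * (c * σ * p + y * q) + (c * σ)^2 + y^2 := by
    rw [hp, hq, hρ]; linear_combination vi - wi
  have k2 : Δ * d^2 = 2 * (p - ρ * c) := by
    have : Δ * (Δ * d^2) = Δ * (2 * (p - ρ * c)) := by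
      rw [hp, hρ]; linear_combination vj - vi + Δ^2 * hcd
    exact mul_left_cancel₀ hΔ.ne' this
  have sp : (d * σ)^2 < y^2 := by
    by_contra! hcon
    -- δ := y^2 - d^2σ^2 ≤ 0
    have vi' : p^2 + q^2 = ρ^2 := vi
    have hN : (c * σ)^2 + y^2 ≤ σ^2 := by
      have : σ^2 = (c * σ)^2 + (d * σ)^2 := by linear_combination (-σ^2) * hcd
      linarith
    have hcs : (c * σ * p + y * q)^2 + (c * σ * q - y * p)^2 = ((c * σ)^2 + y^2) * ρ^2 := by
      rw [← vi']; ring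
    have hD : (c * σ * p + y * q) = ρ * σ + (σ^2 - ((c * σ)^2 + y^2)) / 2 := by linarith
    set δ := σ^2 - ((c * σ)^2 + y^2) with hδ
    have hδ0 : 0 ≤ δ := by linarith
    have hcs2 : (ρ * σ + δ / 2)^2 + (c * σ * q - y * p)^2 = (σ^2 - δ) * ρ^2 := by
      rw [← hD, hcs, hδ]; ring
    have hsum : ρ * (ρ + σ) * δ + δ^2 / 4 + (c * σ * q - y * p)^2 = 0 := by
      linear_combination hcs2
    have hρσ : 0 ≤ ρ + σ := by rw [hρ]; linarith
    have z1 : 0 ≤ ρ * (ρ + σ) * δ := mul_nonneg (mul_nonneg vi0 hρσ) hδ0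
    have y1 := sq_nonneg δ
    have y2 := sq_nonneg (c * σ * q - y * p)
    have z2 : δ^2 = 0 := by linarith
    have z3 : (c * σ * q - y * p)^2 = 0 := by linarith
    have z4 : δ = 0 := pow_eq_zero_iff (two_ne_zero) |>.1 z2
    have z5 : c * σ * q - y * p = 0 := pow_eq_zero_iff (two_ne_zero) |>.1 z3
    have z6 : y * q + c * σ * p = ρ * σ := by rw [z4] at hD; linarith
    have z7 : y^2 = d^2 * σ^2 := by rw [hδ] at z4; linear_combination (-σ^2) * hcd - z4
    -- p y = cσ q ; y(p - ρ c) = cσ q - ρ c y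
    have z8 : (y * (p - ρ * c))  = c * (σ * q - ρ * y) := by linear_combination -z5
    have z9 : σ * q * y = σ * (ρ * σ - c * σ * p) := by rw [← z6]; ring
    have z10 : y * (y * (p - ρ * c)) = - (c^2 * σ^2) * (p - ρ * c) := by
      rw [z8]; linear_combination c * z9 - c * ρ * z7 - c * ρ * σ^2 * hcd
    have pc : 0 < p - ρ * c := by
      have : 0 < Δ * d^2 := by positivity
      linarith
    have : 0 < (y^2 + c^2 * σ^2) * (p - ρ * c) := by positivity
    linarith
  have ab := abs_lt_of_sq_lt_sq sp hy0.le
  have ab' := abs_lt.1 ab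
  have hlin : 0 ≤ c * σ * (h0 - i0) + y * (h1 - i1) + σ * (rh - ri) := by
    have e1 := k1
    rw [hp, hq, hρ] at e1
    linarith
  set a := c * (h0 - i0) + d * (h1 - i1) + (rh - ri) with had
  set b := c * (h0 - i0) - d * (h1 - i1) + (rh - ri) with hbd
  have hlin2 : 0 ≤ a * (d * σ + y) + b * (d * σ - y) := by
    have : a * (d * σ + y) + b * (d * σ - y)
      = 2 * d * (c * σ * (h0 - i0) + y * (h1 - i1) + σ * (rh - ri)) := by rw [had, hbd]; ring
    rw [this]; positivity
  have u1 : 0 < d * σ + y := by linarith [ab'.1]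
  have u2 : d * σ - y < 0 := by linarith [ab'.2]
  have a0 : a = 0 := by
    by_contra h
    have h' : a < 0 := lt_of_le_of_ne ha h
    have := mul_neg_of_neg_of_pos h' u1
    have := mul_nonpos_of_nonneg_of_nonpos hb u2.le
    linarith
  have b0 : b = 0 := by
    by_contra h
    have h' : 0 < b := lt_of_le_of_ne hb (Ne.symm h)
    have := mul_neg_of_pos_of_neg h' u2
    have := mul_nonpos_of_nonpos_of_nonneg ha u1.le
    linarith
  have hh1 : h1 = i1 := by
    have : d * (h1 - i1) = 0 := by linarith
    have := (mul_eq_zero.1 this).resolve_left hd.ne'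
    linarith
  have hrh : rh = ri - c * (h0 - i0) := by rw [had, hh1] at a0; linarith
  refine ⟨hh1, ?_⟩
  have hk : (h0 - i0) * (d^2 * (h0 - i0 - Δ)) = 0 := by
    rw [hh1, hrh] at vh
    rw [hp, hρ] at k2
    linear_combination vh - vi + (h0 - i0)^2 * hcd - (h0 - i0) * k2
  rcases mul_eq_zero.1 hk with h | h
  · left
    refine ⟨by linarith, by rw [hrh, h]; ring⟩
  · right
    have := (mul_eq_zero.1 h).resolve_left (by positivity)
    have e : h0 - i0 = Δ := by linarith
    exact ⟨by linarith, by rw [hrh, e]⟩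

/-- support value -/
def Disk.hv (D : Disk) (a b : ℝ) : ℝ := a * D.center 0 + b * D.center 1 + D.radius

/-- extreme point -/
def Disk.tp (D : Disk) (a b : ℝ) : Pt := !₂[D.center 0 + D.radius * a, D.center 1 + D.radius * b]

lemma Disk.tp0 (D : Disk) (a b : ℝ) : D.tp a b 0 = D.center 0 + D.radius * a := rfl
lemma Disk.tp1 (D : Disk) (a b : ℝ) : D.tp a b 1 = D.center 1 + D.radius * b := rfl

lemma Disk.le_hv (D : Disk) (z : Pt) (hz : z ∈ D.pts) (a b : ℝ) (hab : a^2 + b^2 = 1) :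
    a * z 0 + b * z 1 ≤ D.hv a b := by
  have h1 : dist z D.center ≤ D.radius := hz
  have h2 := dist_sq' z D.center
  have h3 : (a * (z 0 - D.center 0) + b * (z 1 - D.center 1))^2 ≤ dist z D.center ^ 2 := by
    rw [h2]
    have : (a * (z 0 - D.center 0) + b * (z 1 - D.center 1))^2
      + (a * (z 1 - D.center 1) - b * (z 0 - D.center 0))^2
      = (z 0 - D.center 0)^2 + (z 1 - D.center 1)^2 := by
      linear_combination ((z 0 - D.center 0)^2 + (z 1 - D.center 1)^2) * hab
    have := sq_nonneg (a * (z 1 - D.center 1) - b * (z 0 - D.center 0))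
    linarith
  have h4 := abs_le_of_sq_le_sq' h3 dist_nonneg
  unfold Disk.hv
  linarith [h4.2]

lemma Disk.tp_dist (D : Disk) (hr : 0 ≤ D.radius) (a b : ℝ) (hab : a^2 + b^2 = 1) :
    dist (D.tp a b) D.center = D.radius := by
  have h := dist_sq' (D.tp a b) D.center
  rw [D.tp0, D.tp1] at h
  have : dist (D.tp a b) D.center ^ 2 = D.radius ^ 2 := by
    rw [h]; linear_combination D.radius^2 * hab
  exact (pow_left_inj₀ dist_nonneg hr two_ne_zero).1 this

lemma Disk.tp_dot (D : Disk) (a b : ℝ) (hab : a^2 + b^2 = 1) :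
    a * D.tp a b 0 + b * D.tp a b 1 = D.hv a b := by
  rw [D.tp0, D.tp1]; unfold Disk.hv; linear_combination D.radius * hab

lemma Disk.eq_tp (D : Disk) (z : Pt) (hz : z ∈ D.pts) (a b : ℝ) (hab : a^2 + b^2 = 1)
    (h : a * z 0 + b * z 1 = D.hv a b) : z 0 = D.tp a b 0 ∧ z 1 = D.tp a b 1 := by
  have h1 : dist z D.center ≤ D.radius := hz
  have h2 := dist_sq' z D.center
  have h3 : dist z D.center ^ 2 ≤ D.radius ^ 2 := pow_le_pow_left₀ dist_nonneg h1 2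
  rw [D.tp0, D.tp1]
  unfold Disk.hv at h
  have h5 : (z 0 - (D.center 0 + D.radius * a))^2 + (z 1 - (D.center 1 + D.radius * b))^2
      = dist z D.center ^ 2 - D.radius ^ 2 := by
    rw [h2]; linear_combination (-2 * D.radius) * h + D.radius^2 * hab
  have s1 := sq_nonneg (z 0 - (D.center 0 + D.radius * a))
  have s2 := sq_nonneg (z 1 - (D.center 1 + D.radius * b))
  constructor
  · have := pow_eq_zero_iff (two_ne_zero) |>.1 (le_antisymm (by linarith) s1)
    linarith
  · have := pow_eq_zero_iff (two_ne_zero) |>.1 (le_antisymm (by linarith) s2)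
    linarith

lemma pts_sub (S : Set Disk) (D : Disk) (hD : D ∈ S) : D.pts ⊆ diskHull S :=
  (subset_biUnion_of_mem (u := fun D : Disk => D.pts) hD).trans (subset_convexHull ℝ _)

lemma hull_le (S : Set Disk) (a b M : ℝ) (hab : a^2 + b^2 = 1) (h : ∀ D ∈ S, D.hv a b ≤ M) :
    ∀ z ∈ diskHull S, a * z 0 + b * z 1 ≤ M := by
  have hc : Convex ℝ {z : Pt | a * z 0 + b * z 1 ≤ M} := by
    intro x hx y hy s t hs ht hst
    simp only [mem_ofPred_eq] at hx hy ⊢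
    simp only [PiLp.add_apply, PiLp.smul_apply, smul_eq_mul]
    have h1 := mul_le_mul_of_nonneg_left hx hs
    have h2 := mul_le_mul_of_nonneg_left hy ht
    have h3 : s * M + t * M = M := by rw [← add_mul, hst, one_mul]
    linarith
  have : diskHull S ⊆ {z : Pt | a * z 0 + b * z 1 ≤ M} := by
    apply convexHull_min _ hc
    intro z hz
    simp only [diskUnion, mem_iUnion] at hz
    obtain ⟨D, hD, hzD⟩ := hz
    exact (D.le_hv z hzD a b hab).trans (h D hD)
  intro z hz
  exact this hz

lemma arc_mem (S : Set Disk) (D : Disk) (hD : D ∈ S) (z : Pt) :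
    z ∈ hullArc S D ↔ dist z D.center = D.radius ∧ z ∉ interior (diskHull S) := by
  constructor
  · rintro ⟨h1, h2⟩
    exact ⟨h1, h2.2⟩
  · rintro ⟨h1, h2⟩
    exact ⟨h1, subset_closure (pts_sub S D hD (show dist z D.center ≤ D.radius from h1.le)), h2⟩

lemma tp_arc (S : Set Disk) (D : Disk) (hD : D ∈ S) (hr : 0 ≤ D.radius) (a b : ℝ)
    (hab : a^2 + b^2 = 1) (h : ∀ E ∈ S, E.hv a b ≤ D.hv a b) : D.tp a b ∈ hullArc S D := by
  rw [arc_mem S D hD]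
  refine ⟨D.tp_dist hr a b hab, not_mem_interior_of_support _ _ a b hab ?_⟩
  rw [D.tp_dot a b hab]
  exact hull_le S a b _ hab h

lemma not_mem_of_disj (D E : Disk) (h : D.Disj E) (z : Pt) (hz : z ∈ D.pts) : z ∉ E.pts := by
  intro hz'
  have h1 : dist z D.center ≤ D.radius := hz
  have h2 : dist z E.center ≤ E.radius := hz'
  have h3 : D.radius + E.radius < dist D.center E.center := h
  have := dist_triangle_left D.center E.center z
  linarith

lemma geom (𝒟 : Set Disk) (hsc : StronglyConvexPos 𝒟)
    (Di Dj Dh : Disk) (hi : Di ∈ 𝒟) (hj : Dj ∈ 𝒟) (hh : Dh ∈ 𝒟)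
    (hy : Di.center 1 = Dj.center 1) (hx : Di.center 0 < Dj.center 0)
    (hsch : StronglyConvexIndep {Di, Dj, Dh})
    (hij : Di.Disj Dj) (hih : Di.Disj Dh) (hjh : Dj.Disj Dh)
    (ri : 0 ≤ Di.radius) (rj : 0 ≤ Dj.radius) (rh : 0 ≤ Dh.radius)
    (hsep : Di.center 0 + Di.radius < Dj.center 0 - Dj.radius)
    (hbh : CCWBetween 𝒟 Di Dh Dj) (c d : ℝ) (hd : 0 < d) (hcd : c^2 + d^2 = 1)
    (hr : Dj.radius = Di.radius - c * (Dj.center 0 - Di.center 0)) :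
    Dh.hv c d ≤ Di.hv c d ∧ Di.hv c (-d) ≤ Dh.hv c (-d) := by
  obtain ⟨o, ho, hccw⟩ := hbh
  obtain ⟨qi, hqi⟩ := (hsc Di hi).nonempty
  obtain ⟨qj, hqj⟩ := (hsc Dj hj).nonempty
  obtain ⟨qh, hqh⟩ := (hsc Dh hh).nonempty
  have hK : 0 < cross qi qh qj := by
    obtain ⟨k1, k2, k3⟩ := hccw qi hqi qh hqh qj hqj
    have : cross qi qh qj = cross o qi qh + cross o qh qj + cross o qj qi := by
      unfold cross; ring
    linarith
  set T : Set Disk := {Di, Dj, Dh} with hT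
  have hTD : T ⊆ 𝒟 := by
    intro D hD
    rcases hD with rfl | rfl | rfl <;> assumption
  have iT : Di ∈ T := by simp [hT]
  have jT : Dj ∈ T := by simp [hT]
  have hT' : Dh ∈ T := by simp [hT]
  have hTall : ∀ a b M : ℝ, Di.hv a b ≤ M → Dj.hv a b ≤ M → Dh.hv a b ≤ M →
      ∀ E ∈ T, E.hv a b ≤ M := by
    rintro a b M h1 h2 h3 D (rfl | rfl | rfl) <;> assumption
  have hsubset : diskHull T ⊆ diskHull 𝒟 :=
    convexHull_mono (biUnion_subset_biUnion_left hTD)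
  have arcsub : ∀ D ∈ T, hullArc 𝒟 D ⊆ hullArc T D := by
    intro D hD z hz
    rw [arc_mem 𝒟 D (hTD hD)] at hz
    rw [arc_mem T D hD]
    exact ⟨hz.1, fun h => hz.2 (interior_mono hsubset h)⟩
  have ai := arcsub Di iT hqi
  have aj := arcsub Dj jT hqj
  have ah := arcsub Dh hT' hqh
  have arc_pts : ∀ (D : Disk) (z : Pt), z ∈ hullArc T D → z ∈ D.pts := by
    intro D z hz
    exact (show dist z D.center ≤ D.radius from le_of_eq hz.1)
  have arc_T : ∀ D ∈ T, ∀ z : Pt, z ∈ hullArc T D → z ∈ diskHull T ∧ z ∉ interior (diskHull T) := by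
    intro D hD z hz
    exact ⟨pts_sub T D hD (arc_pts D z hz), hz.2.2⟩
  have cT : Convex ℝ (diskHull T) := convex_convexHull ℝ _
  have hne : (interior (diskHull T)).Nonempty :=
    interior_of_tri _ cT qi qh qj (arc_T _ iT _ ai).1 (arc_T _ hT' _ ah).1 (arc_T _ jT _ aj).1 hK
  have nosep : ∀ A ∈ T, ∀ P ∈ T, ∀ Q ∈ T, P.Disj A → Q.Disj A → P.Disj Q → ∀ p q x y : Pt,
      p ∈ hullArc T P → q ∈ hullArc T Q → x ∈ hullArc T A → y ∈ hullArc T A →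
      cross p q x < 0 → cross p q y ≤ 0 := by
    intro A hA P hP Q hQ d1 d2 d3 p q x y hp hq hx hy hc
    refine cross_no_sep _ cT hne (hullArc T A) (hsch.1 A hA) (arc_T A hA) p q x y
      (arc_T P hP p hp).1 (arc_T P hP p hp).2 (arc_T Q hQ q hq).1 (arc_T Q hQ q hq).2
      ?_ ?_ ?_ hx hy hc
    · exact fun h => not_mem_of_disj P A d1 p (arc_pts P p hp) (arc_pts A p h)
    · exact fun h => not_mem_of_disj Q A d2 q (arc_pts Q q hq) (arc_pts A q h)
    · rintro rfl
      exact not_mem_of_disj P Q d3 p (arc_pts P p hp) (arc_pts Q p hq)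
  have symm : ∀ D E : Disk, D.Disj E → E.Disj D := by
    intro D E h
    unfold Disk.Disj at h ⊢
    rw [dist_comm]; linarith
  -- supports
  obtain ⟨e0, e1, he, hes⟩ := exists_support _ cT hne qi (arc_T _ iT _ ai).2
  obtain ⟨f0, f1, hf, hfs⟩ := exists_support _ cT hne qj (arc_T _ jT _ aj).2
  obtain ⟨g0, g1, hg, hgs⟩ := exists_support _ cT hne qh (arc_T _ hT' _ ah).2
  have hvle : ∀ a b : ℝ, a^2 + b^2 = 1 → ∀ z : Pt, (∀ y ∈ diskHull T, a * y 0 + b * y 1 ≤ a * z 0 + b * z 1) →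
      ∀ D ∈ T, 0 ≤ D.radius → D.hv a b ≤ a * z 0 + b * z 1 := by
    intro a b hab z hz D hD hr
    rw [← D.tp_dot a b hab]
    exact hz _ (pts_sub T D hD (show dist _ D.center ≤ D.radius from (D.tp_dist hr a b hab).le))
  have heji : Dj.hv e0 e1 ≤ Di.hv e0 e1 :=
    (hvle e0 e1 he qi hes Dj jT rj).trans (Di.le_hv qi (arc_pts _ _ ai) e0 e1 he)
  have hfij : Di.hv f0 f1 ≤ Dj.hv f0 f1 :=
    (hvle f0 f1 hf qj hfs Di iT ri).trans (Dj.le_hv qj (arc_pts _ _ aj) f0 f1 hf)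
  set Δ := Dj.center 0 - Di.center 0 with hΔ
  have hΔ0 : 0 < Δ := by rw [hΔ]; linarith
  have hvdiff : ∀ a b : ℝ, Dj.hv a b - Di.hv a b = (a - c) * Δ := by
    intro a b; unfold Disk.hv; rw [hr, ← hy, hΔ]; ring
  have hec : e0 ≤ c := by
    by_contra! h
    have := mul_pos (sub_pos.2 h) hΔ0
    linarith [hvdiff e0 e1]
  have hfc : c ≤ f0 := by
    by_contra! h
    have := mul_neg_of_neg_of_pos (sub_neg.2 h) hΔ0
    linarith [hvdiff f0 f1]
  have eqv : ∀ b, Dj.hv c b = Di.hv c b := by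
    intro b; have := hvdiff c b; linarith
  have xi : ∀ z ∈ Di.pts, z 0 ≤ Di.center 0 + Di.radius := by
    intro z hz
    have := Di.le_hv z hz 1 0 (by norm_num)
    unfold Disk.hv at this; linarith
  have xj : ∀ z ∈ Dj.pts, Dj.center 0 - Dj.radius ≤ z 0 := by
    intro z hz
    have := Dj.le_hv z hz (-1) 0 (by norm_num)
    unfold Disk.hv at this; linarith
  have qi_pts := arc_pts _ _ ai
  have qj_pts := arc_pts _ _ aj
  have qh_pts := arc_pts _ _ ah
  have hcd' : c^2 + (-d)^2 = 1 := by rw [neg_sq]; exact hcd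
  have qiT := (arc_T _ iT _ ai).1
  have qjT := (arc_T _ jT _ aj).1
  have qhT := (arc_T _ hT' _ ah).1
  constructor
  · by_contra! hcon
    have hs : Dh.tp c d ∈ hullArc T Dh :=
      tp_arc T Dh hT' rh c d hcd (hTall c d _ hcon.le (by rw [eqv]; exact hcon.le) le_rfl)
    have hsdot := Dh.tp_dot c d hcd
    set s := Dh.tp c d with hsdef
    have hsT := (arc_T _ hT' _ hs).1
    have hcr : cross qi qj s ≤ 0 := by
      refine nosep Dh hT' Di iT Dj jT hih hjh hij qi qj qh s ai aj ah hs ?_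
      unfold cross at hK ⊢; linarith
    have li := Di.le_hv qi qi_pts c d hcd
    have lj := Dj.le_hv qj qj_pts c d hcd
    rw [eqv] at lj
    have xi' := xi qi qi_pts
    have xj' := xj qj qj_pts
    have E1 := hes s hsT
    have E2 := hes qj qjT
    have E3 := hes qh qhT
    have F1 := hfs s hsT
    have F2 := hfs qi qiT
    have F3 := hfs qh qhT
    unfold cross at hK hcr
    exact caseA (qj 0 - qi 0) (qj 1 - qi 1) (s 0 - qi 0) (s 1 - qi 1) (qh 0 - qi 0) (qh 1 - qi 1)
      e0 e1 f0 f1 c d (by linarith) (by linarith) (by linarith) (by linarith) (by linarith)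
      (by linarith) (by linarith) (by linarith) (by linarith) (by linarith) (by linarith)
      he hf hcd hd hec hfc
  · by_contra! hcon
    have hti : Di.tp c (-d) ∈ hullArc T Di :=
      tp_arc T Di iT ri c (-d) hcd' (hTall c (-d) _ le_rfl (eqv _).le hcon.le)
    have htj : Dj.tp c (-d) ∈ hullArc T Dj :=
      tp_arc T Dj jT rj c (-d) hcd' (by rw [eqv]; exact hTall c (-d) _ le_rfl (eqv _).le hcon.le)
    have di := Di.tp_dot c (-d) hcd'
    have dj := Dj.tp_dot c (-d) hcd'
    rw [eqv] at dj
    have hqhv := Dh.le_hv qh qh_pts c (-d) hcd'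
    have hqiv := Di.le_hv qi qi_pts c (-d) hcd'
    have hqjv := Dj.le_hv qj qj_pts c (-d) hcd'
    rw [eqv] at hqjv
    have ui := Di.eq_tp qi qi_pts c (-d) hcd'
    have uj := Dj.eq_tp qj qj_pts c (-d) hcd'
    rw [eqv] at uj
    have hdiff0 : Dj.tp c (-d) 0 - Di.tp c (-d) 0 = Δ * d * d := by
      rw [Disk.tp0, Disk.tp0, hr]; linear_combination (-Δ) * hcd - hΔ
    have hdiff1 : Dj.tp c (-d) 1 - Di.tp c (-d) 1 = Δ * d * c := by
      rw [Disk.tp1, Disk.tp1, hr]; linear_combination -hy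
    set ti := Di.tp c (-d) with htid
    set tj := Dj.tp c (-d) with htjd
    have hκ : 0 < cross qh ti tj := by
      have : cross qh ti tj = (Δ * d) * (Di.hv c (-d) - (c * qh 0 + -d * qh 1)) := by
        rw [← di]; unfold cross
        linear_combination (ti 0 - qh 0) * hdiff1 - (ti 1 - qh 1) * hdiff0
      rw [this]
      exact mul_pos (mul_pos hΔ0 hd) (by linarith)
    have tiT := (arc_T _ iT _ hti).1
    have tjT := (arc_T _ jT _ htj).1
    have N1 : cross qh tj qi ≤ 0 := by
      refine nosep Di iT Dh hT' Dj jT (symm _ _ hih) (symm _ _ hij) (symm _ _ hjh) qh tj ti qi ah htj hti ai ?_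
      unfold cross at hκ ⊢; linarith
    have N2 : cross ti qh qj ≤ 0 := by
      refine nosep Dj jT Di iT Dh hT' hij (symm _ _ hjh) hih ti qh tj qj hti ah htj aj ?_
      unfold cross at hκ ⊢; linarith
    have x1 := xi qi qi_pts
    have x2 := xi ti (arc_pts _ _ hti)
    have x3 := xj qj qj_pts
    have x4 := xj tj (arc_pts _ _ htj)
    have E1 := hes qh qhT
    have E2 := hes ti tiT
    have E3 := hes tj tjT
    have F1 := hfs qh qhT
    have F2 := hfs ti tiT
    have F3 := hfs tj tjT
    have G1 := hgs qi qiT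
    have G2 := hgs qj qjT
    have G3 := hgs ti tiT
    have G4 := hgs tj tjT
    unfold cross at hκ N1 N2 hK
    refine caseB (ti 0 - qh 0) (ti 1 - qh 1) (tj 0 - qh 0) (tj 1 - qh 1) (qi 0 - qh 0) (qi 1 - qh 1)
      (qj 0 - qh 0) (qj 1 - qh 1) c (-d) (Di.hv c (-d) - (c * qh 0 + -d * qh 1))
      ((Di.center 0 + Di.radius + (Dj.center 0 - Dj.radius)) / 2 - qh 0) e0 e1 f0 f1 g0 g1
      (by linarith) (by linarith) (by linarith) (by linarith) (by linarith) (by linarith)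
      ?_ ?_ (by linarith) (by linarith) (by linarith) (by linarith) (by linarith) (by linarith)
      (by linarith) hg (by linarith) (by linarith) (by linarith) (by linarith)
      he (by linarith) (by linarith) (by linarith) hf (by linarith) (by linarith) (by linarith)
    · intro h
      obtain ⟨h1, h2⟩ := ui (by linarith)
      exact ⟨by linarith, by linarith⟩
    · intro h
      obtain ⟨h1, h2⟩ := uj (by linarith)
      exact ⟨by linarith, by linarith⟩

/-- for `Dh, Dl` between `Di` and `Dj` in ccw hull order with strongly convex
independent triples and equidistant points `vijh, vijl`, if `vijh` lies below `vijl` on the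
bisector, then `vijl` is strictly closer in signed distance to `Di` than to `Dh`. -/
theorem stmt8 (𝒟 : Set Disk) (hfin : 𝒟.Finite) (hsc : StronglyConvexPos 𝒟)
    (Di Dj Dh Dl : Disk) (hi : Di ∈ 𝒟) (hj : Dj ∈ 𝒟) (hh : Dh ∈ 𝒟) (hl : Dl ∈ 𝒟)
    (hy : Di.center 1 = Dj.center 1) (hx : Di.center 0 < Dj.center 0)
    (hsch : StronglyConvexIndep {Di, Dj, Dh}) (hscl : StronglyConvexIndep {Di, Dj, Dl})
    (vijh vijl : Pt)
    (hvh : Di.sd vijh = Dj.sd vijh ∧ Dj.sd vijh = Dh.sd vijh)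
    (hvl : Di.sd vijl = Dj.sd vijl ∧ Dj.sd vijl = Dl.sd vijl)
    (hbh : CCWBetween 𝒟 Di Dh Dj) (hbl : CCWBetween 𝒟 Di Dl Dj)
    (hlt : vijh 1 < vijl 1) :
    Di.sd vijl < Dh.sd vijl := by
  have rad : ∀ D ∈ 𝒟, 0 ≤ D.radius := by
    intro D hD
    obtain ⟨q, hq⟩ := (hsc D hD).nonempty
    have : dist q D.center = D.radius := hq.1
    rw [← this]; exact dist_nonneg
  have ri := rad Di hi
  have rj := rad Dj hj
  have rh := rad Dh hh
  have hneij : Di ≠ Dj := by rintro rfl; exact lt_irrefl _ hx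
  have hne2 : Di ≠ Dh ∧ Dj ≠ Dh := by
    obtain ⟨o, ho, hccw⟩ := hbh
    obtain ⟨qi, hqi⟩ := (hsc Di hi).nonempty
    obtain ⟨qj, hqj⟩ := (hsc Dj hj).nonempty
    have cs : ∀ q : Pt, cross o q q = 0 := by intro q; unfold cross; ring
    constructor
    · rintro rfl
      have := (hccw qi hqi qi hqi qj hqj).1
      rw [cs] at this; exact lt_irrefl _ this
    · rintro rfl
      have := (hccw qi hqi qj hqj qj hqj).2.1
      rw [cs] at this; exact lt_irrefl _ this
  have hij : Di.Disj Dj := hsch.2 Di (by simp) Dj (by simp) hneij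
  have hih : Di.Disj Dh := hsch.2 Di (by simp) Dh (by simp) hne2.1
  have hjh : Dj.Disj Dh := hsch.2 Dj (by simp) Dh (by simp) hne2.2
  have hdij : dist Di.center Dj.center = Dj.center 0 - Di.center 0 := by
    have h := dist_sq' Di.center Dj.center
    rw [hy] at h
    exact (pow_left_inj₀ dist_nonneg (by linarith) two_ne_zero).1 (by rw [h]; ring)
  have hsep : Di.radius + Dj.radius < Dj.center 0 - Di.center 0 := by rw [← hdij]; exact hij
  set Δ := Dj.center 0 - Di.center 0 with hΔ
  have hΔ0 : 0 < Δ := by linarith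
  obtain ⟨c, hc⟩ : ∃ c, c * Δ = Di.radius - Dj.radius := ⟨(Di.radius - Dj.radius) / Δ, by field_simp⟩
  have c1 : c < 1 := by
    by_contra! h
    have := mul_le_mul_of_nonneg_right h hΔ0.le
    linarith
  have c2 : -1 < c := by
    by_contra! h
    have := mul_le_mul_of_nonneg_right h hΔ0.le
    linarith
  have hpos : 0 < 1 - c^2 := by nlinarith
  set d := Real.sqrt (1 - c^2) with hdd
  have hd : 0 < d := Real.sqrt_pos.2 hpos
  have hd2 : d^2 = 1 - c^2 := Real.sq_sqrt hpos.le
  have hcd : c^2 + d^2 = 1 := by rw [hd2]; ring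
  obtain ⟨ga, gb⟩ := geom 𝒟 hsc Di Dj Dh hi hj hh hy hx hsch hij hih hjh ri rj rh (by linarith)
    hbh c d hd hcd (by rw [← hΔ]; linarith)
  by_contra! hcon
  unfold Disk.sd at hvh hvl hcon
  unfold Disk.hv at ga gb
  have hrj : Dj.radius = Di.radius - c * Δ := by linarith
  have hcj : Dj.center 0 = Di.center 0 + Δ := by rw [hΔ]; ring
  have key := final_alg (vijh 0) (vijh 1) (vijl 0) (vijl 1) (Di.center 0) (Di.center 1) Δ
    (Dh.center 0) (Dh.center 1) Di.radius Dh.radius c d (dist vijh Di.center - Di.radius)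
    (dist vijl Di.center - Di.radius) hΔ0 hd hcd
    (by rw [← dist_sq']; ring) (by linarith [dist_nonneg (x := vijh) (y := Di.center)])
    (by rw [← hcj, hy, ← dist_sq', ← hrj, hvh.1]; ring)
    (by rw [← dist_sq', hvh.1, hvh.2]; ring)
    (by rw [← dist_sq']; ring) (by linarith [dist_nonneg (x := vijl) (y := Di.center)])
    (by rw [← hcj, hy, ← dist_sq', ← hrj, hvl.1]; ring)
    (by rw [← dist_sq']; exact pow_le_pow_left₀ dist_nonneg (by linarith) 2)
    hlt (by linarith) (by linarith)
  obtain ⟨k1, ⟨k2, k3⟩ | ⟨k2, k3⟩⟩ := key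
  · have h := dist_sq' Di.center Dh.center
    have h' : Di.radius + Dh.radius < dist Di.center Dh.center := hih
    rw [k1, k2] at h
    have : dist Di.center Dh.center = 0 := pow_eq_zero_iff (two_ne_zero) |>.1 (by rw [h]; ring)
    linarith
  · have h := dist_sq' Dj.center Dh.center
    have h' : Dj.radius + Dh.radius < dist Dj.center Dh.center := hjh
    rw [k1, k2, hcj, hy] at h
    have : dist Dj.center Dh.center = 0 := pow_eq_zero_iff (two_ne_zero) |>.1 (by rw [h]; ring)
    linarith
end
end

section
/- Let S be a finite independent set of disks (pairwise disjoint) in strongly convex position, containing two disks D_i and D_j with centers on a common horizontal line (p_i left of p_j), such that all other disks of S lie between D_i and D_j in counterclockwise hull order (i.e., in the hull arc from D_i to D_j counterclockwise). Then the hull edge of conv(S) connecting the arcs of D_i and D_j is the upper common tangent segment of D_i and D_j, and at least one disk of S \ {D_i, D_j} contains a point strictly below the supporting line of the lower common tangent of D_i and D_j; consequently S \ {D_i, D_j} contains a disk D such that {D, D_i, D_j} is a strongly convex independent set. -/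
open Metric Set
open scoped RealInnerProductSpace

noncomputable section

/-- Support value of a disk in a unit direction. -/
def hh (D : Disk) (u : Pt) : ℝ := ⟪u, D.center⟫ + D.radius

/-- The disk `D` is extremal in direction `u`. -/
def Act (S : Set Disk) (D : Disk) (u : Pt) : Prop := ∀ E ∈ S, hh E u ≤ hh D u

lemma inner2 (u v : Pt) : ⟪u, v⟫ = u 0 * v 0 + u 1 * v 1 := by
  simp [PiLp.inner_apply, Fin.sum_univ_two]; ring

lemma normsq2 (u : Pt) : ‖u‖ ^ 2 = u 0 ^ 2 + u 1 ^ 2 := by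
  simp [EuclideanSpace.norm_sq_eq, Fin.sum_univ_two]

lemma ext2 {u v : Pt} (h0 : u 0 = v 0) (h1 : u 1 = v 1) : u = v := by
  ext i; fin_cases i <;> assumption

lemma inner_le_of_pts {D : Disk} {u z : Pt} (hz : z ∈ D.pts) :
    ⟪u, z⟫ ≤ ⟪u, D.center⟫ + D.radius * ‖u‖ := by
  have h1 : ‖z - D.center‖ ≤ D.radius := by
    simpa [Disk.pts, dist_eq_norm] using hz
  have h2 := real_inner_le_norm u (z - D.center)
  rw [inner_sub_right] at h2
  nlinarith [norm_nonneg u]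

lemma le_hh {D : Disk} {u z : Pt} (hu : ‖u‖ = 1) (hz : z ∈ D.pts) : ⟪u, z⟫ ≤ hh D u := by
  have := inner_le_of_pts (u := u) hz
  simpa [hh, hu] using this

lemma inner_tp {D : Disk} {u : Pt} (hu : ‖u‖ = 1) :
    ⟪u, D.center + D.radius • u⟫ = hh D u := by
  rw [inner_add_right, inner_smul_right, real_inner_self_eq_norm_sq, hu, hh]; ring

lemma tp_mem {D : Disk} {u : Pt} (hu : ‖u‖ = 1) (hr : 0 ≤ D.radius) :
    D.center + D.radius • u ∈ D.pts := by
  simp [Disk.pts, norm_smul, hu, abs_of_nonneg hr]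

lemma hull_le_s14 {S : Set Disk} {D : Disk} {u z : Pt} (hu : ‖u‖ = 1) (hA : Act S D u)
    (hz : z ∈ diskHull S) : ⟪u, z⟫ ≤ hh D u := by
  have hc : Convex ℝ {z : Pt | ⟪u, z⟫ ≤ hh D u} :=
    convex_halfSpace_le (innerSL ℝ u).toLinearMap.isLinear _
  refine convexHull_min ?_ hc hz
  intro z hz
  simp only [diskUnion, mem_iUnion] at hz
  obtain ⟨E, hE, hz⟩ := hz
  exact (le_hh hu hz).trans (hA E hE)

lemma pts_sub_hull {S : Set Disk} {D : Disk} (hD : D ∈ S) : D.pts ⊆ diskHull S := by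
  intro z hz
  apply subset_convexHull
  simp only [diskUnion, mem_iUnion]
  exact ⟨D, hD, hz⟩

lemma frontier_of_max {S : Set Disk} {D : Disk} {u z : Pt} (hu : ‖u‖ = 1) (hA : Act S D u)
    (hz : z ∈ diskHull S) (he : ⟪u, z⟫ = hh D u) : z ∈ frontier (diskHull S) := by
  refine ⟨subset_closure hz, fun hi => ?_⟩
  rw [mem_interior_iff_mem_nhds, Metric.mem_nhds_iff] at hi
  obtain ⟨e, he0, hb⟩ := hi
  have h1 : z + (e / 2) • u ∈ Metric.ball z e := by
    simp [norm_smul, hu, abs_of_pos he0]; linarith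
  have h2 := hull_le_s14 hu hA (hb h1)
  rw [inner_add_right, inner_smul_right, real_inner_self_eq_norm_sq, hu, he] at h2
  linarith

lemma act_mem {S : Set Disk} {D : Disk} {u : Pt} (hu : ‖u‖ = 1) (hD : D ∈ S)
    (hr : 0 ≤ D.radius) (hA : Act S D u) : D.center + D.radius • u ∈ hullArc S D :=
  ⟨by simp [norm_smul, hu, abs_of_nonneg hr],
    frontier_of_max hu hA (pts_sub_hull hD (tp_mem hu hr)) (inner_tp hu)⟩

lemma interior_of_closure {K : Set Pt} (hK : Convex ℝ K) {p : Pt}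
    (hp : p ∈ interior (closure K)) : p ∈ interior K := by
  have hne : (interior K).Nonempty := by
    rw [hK.interior_nonempty_iff_affineSpan_eq_top]
    have h1 : closure K ⊆ (affineSpan ℝ K : Set Pt) :=
      closure_minimal (subset_affineSpan ℝ K) (AffineSubspace.closed_of_finiteDimensional _)
    have h2 : affineSpan ℝ (interior (closure K)) = ⊤ :=
      isOpen_interior.affineSpan_eq_top ⟨p, hp⟩
    rw [eq_top_iff, ← h2, affineSpan_le]
    exact interior_subset.trans h1
  rwa [hK.interior_closure_eq_interior_of_nonempty_interior hne] at hp

lemma exists_dir {S : Set Disk} (hfin : S.Finite) (hr : ∀ D ∈ S, 0 ≤ D.radius)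
    {D : Disk} (hD : D ∈ S) {p : Pt}
    (hp : p ∈ frontier (diskHull S)) : ∃ u : Pt, ‖u‖ = 1 ∧ ∀ E ∈ S, hh E u ≤ ⟪u, p⟫ := by
  by_contra hcon
  push Not at hcon
  have hne : hfin.toFinset.Nonempty := ⟨D, by simpa using hD⟩
  let F : Pt → ℝ := fun u => hfin.toFinset.sup' hne (fun E => hh E u) - ⟪u, p⟫
  have hF : Continuous F := by
    refine Continuous.sub ?_ (by fun_prop)
    refine Continuous.finset_sup'_apply hne ?_
    intro E _
    unfold hh
    fun_prop
  have hcomp : IsCompact (Metric.sphere (0 : Pt) 1) := isCompact_sphere _ _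
  have hsne : (Metric.sphere (0 : Pt) 1).Nonempty := ⟨!₂[1, 0], by
    simp [EuclideanSpace.norm_eq]⟩
  obtain ⟨u0, hu0, hmin⟩ := hcomp.exists_isMinOn hsne hF.continuousOn
  have hpos : 0 < F u0 := by
    obtain ⟨E, hE, h⟩ := hcon u0 (by simpa using hu0)
    have : hh E u0 ≤ hfin.toFinset.sup' hne (fun E => hh E u0) :=
      Finset.le_sup' (fun E => hh E u0) (by simpa using hE)
    simp only [F]; linarith
  apply hp.2
  apply interior_of_closure (convex_convexHull ℝ _)
  rw [mem_interior_iff_mem_nhds, Metric.mem_nhds_iff]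
  refine ⟨F u0, hpos, fun q hq => ?_⟩
  by_contra hqK
  obtain ⟨f, c, hf1, hf2⟩ := geometric_hahn_banach_closed_point
    (convex_convexHull ℝ (diskUnion S)).closure isClosed_closure hqK
  obtain ⟨v, hv⟩ : ∃ v : Pt, ∀ z, f z = ⟪v, z⟫ :=
    ⟨(InnerProductSpace.toDual ℝ Pt).symm f, fun z => by simp⟩
  have hlt : ∀ E ∈ S, ∀ z ∈ E.pts, ⟪v, z⟫ < ⟪v, q⟫ := by
    intro E hE z hz
    have := hf1 z (subset_closure (pts_sub_hull hE hz))
    rw [← hv, ← hv]; linarith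
  have hv0 : v ≠ 0 := by
    rintro rfl
    have := hlt D hD D.center (by simp [Disk.pts, hr D hD])
    simp at this
  have hvn : 0 < ‖v‖ := norm_pos_iff.2 hv0
  set u : Pt := ‖v‖⁻¹ • v with hu
  have hu1 : ‖u‖ = 1 := by simp [hu, norm_smul, hvn.ne']
  have hm := hmin (show u ∈ Metric.sphere (0 : Pt) 1 by simpa using hu1)
  have hm : F u0 ≤ F u := hm
  obtain ⟨E, hE, hEm⟩ := Finset.exists_mem_eq_sup' hne (fun E => hh E u)
  have hE' : E ∈ S := by simpa using hE
  have h3 := hlt E hE' _ (tp_mem hu1 (hr E hE'))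
  have h4 : ⟪u, E.center + E.radius • u⟫ < ⟪u, q⟫ := by
    have e1 : ∀ z : Pt, ⟪u, z⟫ = ‖v‖⁻¹ * ⟪v, z⟫ := fun z => by
      rw [hu, real_inner_smul_left]
    rw [e1, e1 q]
    exact mul_lt_mul_of_pos_left h3 (by positivity)
  rw [inner_tp hu1] at h4
  have h5 : F u = hh E u - ⟪u, p⟫ := by simp only [F]; rw [hEm]
  have h6 : ⟪u, q⟫ - ⟪u, p⟫ ≤ ‖q - p‖ := by
    rw [← inner_sub_right]
    have := real_inner_le_norm u (q - p)
    rwa [hu1, one_mul] at this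
  rw [mem_ball, dist_eq_norm] at hq
  linarith

lemma arc_dir {S : Set Disk} (hfin : S.Finite) (hr : ∀ D ∈ S, 0 ≤ D.radius)
    {D : Disk} (hD : D ∈ S) {p : Pt} (hp : p ∈ hullArc S D) :
    ∃ u : Pt, ‖u‖ = 1 ∧ Act S D u ∧ p = D.center + D.radius • u := by
  obtain ⟨u, hu, h⟩ := exists_dir hfin hr hD hp.2
  have hn : ‖p - D.center‖ = D.radius := by simpa [dist_eq_norm] using hp.1
  have hle : ⟪u, p⟫ ≤ hh D u := le_hh hu (by
    simp [Disk.pts, dist_eq_norm, hn])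
  refine ⟨u, hu, fun E hE => (h E hE).trans hle, ?_⟩
  have h1 := h D hD
  have h2 : ‖p - D.center - D.radius • u‖ ^ 2 ≤ 0 := by
    rw [norm_sub_sq_real, hn, norm_smul, hu, inner_smul_right, inner_sub_left,
      real_inner_comm u p, real_inner_comm u D.center]
    have := hr D hD
    simp only [hh] at h1
    rw [Real.norm_of_nonneg this]
    nlinarith
  have h3 : p - D.center - D.radius • u = 0 := by
    rw [← norm_eq_zero]; exact pow_eq_zero_iff (two_ne_zero) |>.1 (le_antisymm h2 (sq_nonneg _))
  rw [sub_sub, sub_eq_zero] at h3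
  exact h3

lemma arc_eq {S : Set Disk} (hfin : S.Finite) (hr : ∀ D ∈ S, 0 ≤ D.radius)
    {D : Disk} (hD : D ∈ S) :
    hullArc S D = (fun u : Pt => D.center + D.radius • u) '' {u | ‖u‖ = 1 ∧ Act S D u} := by
  ext p
  constructor
  · intro hp
    obtain ⟨u, hu, hA, rfl⟩ := arc_dir hfin hr hD hp
    exact ⟨u, ⟨hu, hA⟩, rfl⟩
  · rintro ⟨u, ⟨hu, hA⟩, rfl⟩
    exact act_mem hu hD (hr D hD) hA

/-- Stereographic parametrization of the unit circle minus `w`. -/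
def ster (w : Pt) (t : ℝ) : Pt :=
  !₂[((t ^ 2 - 1) * w 0 - 2 * t * w 1) / (t ^ 2 + 1),
     ((t ^ 2 - 1) * w 1 + 2 * t * w 0) / (t ^ 2 + 1)]

lemma ster_cont (w : Pt) : Continuous (ster w) := by
  unfold ster
  refine (PiLp.continuous_toLp 2 _).comp ?_
  refine continuous_pi fun i => ?_
  fin_cases i
  · simp
    exact Continuous.div (by fun_prop) (by fun_prop) (fun t => by positivity)
  · simp
    exact Continuous.div (by fun_prop) (by fun_prop) (fun t => by positivity)

lemma quad_convex (a b c : ℝ) (ha : a ≤ 0) : Convex ℝ {t : ℝ | 0 ≤ a * t ^ 2 + b * t + c} := by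
  intro x hx y hy α β hα hβ hs
  simp only [mem_ofPred_eq, smul_eq_mul] at *
  have e : β = 1 - α := by linarith
  subst e
  nlinarith [mul_nonneg (mul_nonneg hα hβ) (mul_nonneg (neg_nonneg.2 ha) (sq_nonneg (x - y))),
    mul_nonneg hα hx, mul_nonneg hβ hy]

lemma ster_ineq (w v : Pt) (c t : ℝ) :
    (0 ≤ ⟪ster w t, v⟫ + c) ↔
      0 ≤ (⟪w, v⟫ + c) * t ^ 2 + (2 * (w 0 * v 1 - w 1 * v 0)) * t + (c - ⟪w, v⟫) := by
  have hp : (0 : ℝ) < t ^ 2 + 1 := by positivity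
  have : ⟪ster w t, v⟫ + c = ((⟪w, v⟫ + c) * t ^ 2 + (2 * (w 0 * v 1 - w 1 * v 0)) * t
      + (c - ⟪w, v⟫)) / (t ^ 2 + 1) := by
    simp only [inner2, ster]
    simp
    field_simp
    ring
  rw [this]
  constructor
  · intro h
    by_contra hn
    push Not at hn
    exact absurd h (not_le.2 (div_neg_of_neg_of_pos hn hp))
  · intro h
    exact div_nonneg h hp.le

lemma ster_norm {w : Pt} (hw : ‖w‖ = 1) (t : ℝ) : ‖ster w t‖ = 1 := by
  have h1 := normsq2 w
  rw [hw] at h1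
  have h2 : ‖ster w t‖ ^ 2 = 1 := by
    rw [normsq2]
    simp only [ster]
    simp
    field_simp
    linear_combination (-(t ^ 2 + 1) ^ 2) * h1
  nlinarith [norm_nonneg (ster w t)]

lemma ster_surj {w u : Pt} (hw : ‖w‖ = 1) (hu : ‖u‖ = 1) (hne : u ≠ w) :
    ∃ t, ster w t = u := by
  have h1 := normsq2 w
  have h2 := normsq2 u
  rw [hw] at h1
  rw [hu] at h2
  have hlt : 0 < 1 - (w 0 * u 0 + w 1 * u 1) := by
    have : 0 < (u 0 - w 0) ^ 2 + (u 1 - w 1) ^ 2 := by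
      by_contra hn
      push Not at hn
      apply hne
      apply ext2 <;> nlinarith [sq_nonneg (u 0 - w 0), sq_nonneg (u 1 - w 1)]
    nlinarith
  set k := 1 - (w 0 * u 0 + w 1 * u 1) with hk
  set j := w 0 * u 1 - w 1 * u 0 with hj
  have hjk : j ^ 2 = k * (2 - k) := by
    rw [hj, hk]
    linear_combination (-(u 0 ^ 2 + u 1 ^ 2)) * h1 - h2
  have hden : (j / k) ^ 2 + 1 = 2 / k := by
    rw [div_pow, hjk]; field_simp; ring
  have hnum : (j / k) ^ 2 - 1 = 2 * (1 - k) / k := by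
    rw [div_pow, hjk]; field_simp; ring
  refine ⟨j / k, ext2 ?_ ?_⟩
  · simp only [ster, hden, hnum]
    simp
    field_simp
    rw [hk, hj]
    linear_combination (-(u 0)) * h1
  · simp only [ster, hden, hnum]
    simp
    field_simp
    rw [hk, hj]
    linear_combination (-(u 1)) * h1

lemma arc_preconn {w v1 v2 : Pt} {c1 c2 : ℝ} (hw : ‖w‖ = 1) (h1 : ⟪w, v1⟫ + c1 ≤ 0)
    (h2 : ⟪w, v2⟫ + c2 < 0) :
    IsPreconnected {u : Pt | ‖u‖ = 1 ∧ 0 ≤ ⟪u, v1⟫ + c1 ∧ 0 ≤ ⟪u, v2⟫ + c2} := by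
  have hc := ((quad_convex (⟪w, v1⟫ + c1) (2 * (w 0 * v1 1 - w 1 * v1 0)) (c1 - ⟪w, v1⟫) h1).inter
    (quad_convex (⟪w, v2⟫ + c2) (2 * (w 0 * v2 1 - w 1 * v2 0)) (c2 - ⟪w, v2⟫) h2.le)).isPreconnected
  have := hc.image (ster w) (ster_cont w).continuousOn
  convert this using 1
  ext u
  constructor
  · rintro ⟨hu, g1, g2⟩
    obtain ⟨t, rfl⟩ := ster_surj hw hu (by rintro rfl; linarith)
    exact ⟨t, ⟨(ster_ineq _ _ _ _).1 g1, (ster_ineq _ _ _ _).1 g2⟩, rfl⟩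
  · rintro ⟨t, ⟨g1, g2⟩, rfl⟩
    exact ⟨ster_norm hw t, (ster_ineq _ _ _ _).2 g1, (ster_ineq _ _ _ _).2 g2⟩

lemma arc3_conn {T : Set Disk} (hfin : T.Finite) (hr : ∀ D ∈ T, 0 ≤ D.radius) {A B C : Disk}
    (hT : ∀ E, E ∈ T ↔ E = A ∨ E = B ∨ E = C) {w w' : Pt} (hw : ‖w‖ = 1) (hw' : ‖w'‖ = 1)
    (h1 : hh A w ≤ hh B w) (h2 : hh A w < hh C w) (h3 : hh B w' ≤ hh A w')
    (h4 : hh C w' ≤ hh A w') : IsConnected (hullArc T A) := by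
  have hA : A ∈ T := (hT A).2 (Or.inl rfl)
  rw [arc_eq hfin hr hA]
  have hset : {u : Pt | ‖u‖ = 1 ∧ Act T A u} = {u : Pt | ‖u‖ = 1 ∧
      0 ≤ ⟪u, A.center - B.center⟫ + (A.radius - B.radius) ∧
      0 ≤ ⟪u, A.center - C.center⟫ + (A.radius - C.radius)} := by
    ext u
    simp only [mem_ofPred_eq, inner_sub_right]
    refine and_congr_right fun _ => ?_
    constructor
    · intro h
      have hB := h B ((hT B).2 (by simp))
      have hC := h C ((hT C).2 (by simp))
      simp only [hh] at hB hC
      constructor <;> linarith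
    · rintro ⟨hB, hC⟩ E hE
      rcases (hT E).1 hE with rfl | rfl | rfl
      · exact le_rfl
      · simp only [hh]; linarith
      · simp only [hh]; linarith
  refine ⟨⟨_, mem_image_of_mem _ (show w' ∈ _ from ⟨hw', ?_⟩)⟩, ?_⟩
  · intro E hE
    rcases (hT E).1 hE with rfl | rfl | rfl
    · exact le_rfl
    · exact h3
    · exact h4
  · refine IsPreconnected.image ?_ _ (by fun_prop)
    rw [hset]
    simp only [hh] at h1 h2
    exact arc_preconn hw (by rw [inner_sub_right]; linarith) (by rw [inner_sub_right]; linarith)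

/-- Two of the three orientations are positive. -/
lemma two_of_three_pos {s t a0 a1 b0 b1 : ℝ} (ht : 0 < t) (hst : s ^ 2 + t ^ 2 = 1)
    (ha : a0 ^ 2 + a1 ^ 2 = 1) (hb : b0 ^ 2 + b1 ^ 2 = 1) (hbs : s < b0) (has : a0 < s) :
    (0 < b0 * t - b1 * s ∧ 0 < s * a1 - t * a0) ∨
    (0 < b0 * t - b1 * s ∧ 0 < a0 * b1 - a1 * b0) ∨
    (0 < s * a1 - t * a0 ∧ 0 < a0 * b1 - a1 * b0) := by
  rcases le_total 0 s with hs | hs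
  · have hb1 : b1 < t := by nlinarith
    have hb1' : -t < b1 := by nlinarith
    have X1 : 0 < b0 * t - b1 * s := by nlinarith
    by_cases X2 : 0 < s * a1 - t * a0
    · exact Or.inl ⟨X1, X2⟩
    push Not at X2
    refine Or.inr (Or.inl ⟨X1, ?_⟩)
    have hs' : 0 < s := by
      rcases hs.eq_or_lt with h | h
      · subst h; nlinarith
      · exact h
    have ha1 : a1 < t := by
      by_contra hn; push Not at hn; nlinarith
    have ha0 : -s ≤ a0 := by
      by_contra hn; push Not at hn
      have : a1 < -t := by
        by_contra hn2; push Not at hn2; nlinarith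
      nlinarith
    have ha1' : a1 ≤ -t := by
      by_contra hn; push Not at hn; nlinarith
    have k1 : s * t < -a1 * b0 := by nlinarith
    have k2 : |a0 * b1| ≤ s * t := by
      rw [abs_mul]
      exact mul_le_mul (abs_le.2 ⟨ha0, has.le⟩) (abs_le.2 ⟨hb1'.le, hb1.le⟩) (abs_nonneg _) hs
    linarith [neg_abs_le (a0 * b1)]
  · have ha1 : a1 < t := by nlinarith
    have ha1' : -t < a1 := by nlinarith
    have X2 : 0 < s * a1 - t * a0 := by nlinarith
    by_cases X1 : 0 < b0 * t - b1 * s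
    · exact Or.inl ⟨X1, X2⟩
    push Not at X1
    refine Or.inr (Or.inr ⟨X2, ?_⟩)
    have hs' : s < 0 := by
      rcases hs.eq_or_lt with h | h
      · subst h; nlinarith
      · exact h
    have hb1 : b1 < t := by
      by_contra hn; push Not at hn; nlinarith
    have hb0 : b0 ≤ -s := by
      by_contra hn; push Not at hn
      have : b1 < -t := by
        by_contra hn2; push Not at hn2; nlinarith
      nlinarith
    have hb1' : b1 ≤ -t := by
      by_contra hn; push Not at hn; nlinarith
    have k1 : (-s) * t < a0 * b1 := by nlinarith
    have k2 : |a1 * b0| ≤ t * (-s) := by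
      rw [abs_mul]
      exact mul_le_mul (abs_le.2 ⟨ha1'.le, ha1.le⟩) (abs_le.2 ⟨by linarith, hb0⟩) (abs_nonneg _) ht.le
    linarith [le_abs_self (a1 * b0)]

/-- Abstract order contradiction in dual coordinates. -/
lemma order_contra {X1 X2 X3 q p β β' α α' Δ : ℝ} (hΔ : 0 < Δ)
    (e1 : X1 * Δ = q * β' - p * β) (e2 : X2 * Δ = p * α' - q * α)
    (e3 : X3 * Δ = α' * β' - α * β)
    (hq : 0 < q) (hp : 0 < p) (hβ : 0 ≤ β) (hβ' : β' ≤ β) (hα : 0 ≤ α) (hα' : α' ≤ α)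
    (h : (0 < X1 ∧ 0 < X2) ∨ (0 < X1 ∧ 0 < X3) ∨ (0 < X2 ∧ 0 < X3)) : False := by
  have f1 : 0 < X1 → 0 < β' ∧ p < q := fun hX => by
    have h1 : 0 < q * β' - p * β := e1 ▸ mul_pos hX hΔ
    have h2 : 0 < β' := by
      by_contra hn; push Not at hn; nlinarith [mul_nonneg hp.le hβ]
    exact ⟨h2, by by_contra hn; push Not at hn; nlinarith⟩
  have f2 : 0 < X2 → 0 < α' ∧ q < p := fun hX => by
    have h1 : 0 < p * α' - q * α := e2 ▸ mul_pos hX hΔ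
    have h2 : 0 < α' := by
      by_contra hn; push Not at hn; nlinarith [mul_nonneg hq.le hα]
    exact ⟨h2, by by_contra hn; push Not at hn; nlinarith⟩
  have f3 : 0 < X3 → 0 < α' * β' - α * β := fun hX => e3 ▸ mul_pos hX hΔ
  rcases h with ⟨a, b⟩ | ⟨a, b⟩ | ⟨a, b⟩
  · linarith [(f1 a).2, (f2 b).2]
  · have := (f1 a).1; have := f3 b; nlinarith
  · have := (f2 a).1; have := f3 b; nlinarith

set_option maxHeartbeats 1600000 in
/-- in a strongly convex independent set `S` with `Di, Dj` on a common horizontal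
line (`Di` left of `Dj`) and all other disks between `Di` and `Dj` in ccw hull order, the hull
edge joining the arcs of `Di` and `Dj` is their upper common tangent segment, and some other
disk of `S` has a point strictly below the lower common tangent line of `Di` and `Dj`;
consequently some `D ∈ S \ {Di, Dj}` makes `{D, Di, Dj}` a strongly convex independent set. -/
theorem stmt14 (S : Set Disk) (hfin : S.Finite) (hsci : StronglyConvexIndep S)
    (hr : ∀ D ∈ S, 0 ≤ D.radius)
    (Di Dj : Disk) (hi : Di ∈ S) (hj : Dj ∈ S) (hij : Di ≠ Dj)
    (hy : Di.center 1 = Dj.center 1) (hx : Di.center 0 < Dj.center 0)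
    (hbetween : ∀ D ∈ S, D ≠ Di → D ≠ Dj → CCWBetween S Di D Dj)
    (hS3 : ∃ D ∈ S, D ≠ Di ∧ D ≠ Dj) :
    -- the hull edge joining the arcs of `Di` and `Dj` is the upper common tangent segment:
    (∃ (x y u : Pt) (c : ℝ), x ∈ hullArc S Di ∧ y ∈ hullArc S Dj ∧
      segment ℝ x y ⊆ frontier (diskHull S) ∧ 0 < u 1 ∧
      ⟪u, x⟫ = c ∧ ⟪u, y⟫ = c ∧
      (∀ z ∈ Di.pts, ⟪u, z⟫ ≤ c) ∧ (∀ z ∈ Dj.pts, ⟪u, z⟫ ≤ c)) ∧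
    -- and for the lower common tangent line of `Di` and `Dj` (downward normal `u'`):
    ∀ (u' : Pt) (c' : ℝ), u' 1 < 0 →
      (∀ z ∈ Di.pts, ⟪u', z⟫ ≤ c') → (∀ z ∈ Dj.pts, ⟪u', z⟫ ≤ c') →
      (∃ z ∈ Di.pts, ⟪u', z⟫ = c') → (∃ z ∈ Dj.pts, ⟪u', z⟫ = c') →
      ∃ D ∈ S, D ≠ Di ∧ D ≠ Dj ∧ (∃ z ∈ D.pts, c' < ⟪u', z⟫) ∧
        StronglyConvexIndep {D, Di, Dj} := by
  classical
  obtain ⟨hsc, hind⟩ := hsci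
  have hri := hr Di hi
  have hrj := hr Dj hj
  set d := Dj.center 0 - Di.center 0 with hd
  have hd0 : 0 < d := by rw [hd]; linarith
  have hdist : Di.radius + Dj.radius < d := by
    have h1 := hind Di hi Dj hj hij
    have h2 : dist Di.center Dj.center = d := by
      rw [EuclideanSpace.dist_eq, Fin.sum_univ_two, hy]
      simp only [dist_self, Real.dist_eq, sq_abs]
      rw [show (Di.center 0 - Dj.center 0) ^ 2 + 0 ^ 2 = d ^ 2 by rw [hd]; ring]
      exact Real.sqrt_sq hd0.le
    rw [← h2]; exact h1
  obtain ⟨s, hs⟩ : ∃ s, s * d = Di.radius - Dj.radius :=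
    ⟨(Di.radius - Dj.radius) / d, by field_simp⟩
  have hs1 : s < 1 := by by_contra hn; push Not at hn; nlinarith
  have hs2 : -1 < s := by by_contra hn; push Not at hn; nlinarith
  obtain ⟨t, ht, hst⟩ : ∃ t : ℝ, 0 < t ∧ s ^ 2 + t ^ 2 = 1 :=
    ⟨Real.sqrt (1 - s ^ 2), Real.sqrt_pos.2 (by nlinarith), by
      rw [Real.sq_sqrt (by nlinarith)]; ring⟩
  have hji : ∀ u : Pt, hh Dj u - hh Di u = (u 0 - s) * d := by
    intro u
    simp only [hh, inner2, hy]
    rw [sub_mul, hs, hd]; ring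
  obtain ⟨up, hup⟩ : ∃ u : Pt, u = !₂[s, t] := ⟨_, rfl⟩
  obtain ⟨um, hum⟩ : ∃ u : Pt, u = !₂[s, -t] := ⟨_, rfl⟩
  have up0 : up 0 = s := by simp [hup]
  have up1 : up 1 = t := by simp [hup]
  have um0 : um 0 = s := by simp [hum]
  have um1 : um 1 = -t := by simp [hum]
  have unit_of : ∀ u : Pt, u 0 ^ 2 + u 1 ^ 2 = 1 → ‖u‖ = 1 := by
    intro u h
    have := normsq2 u
    nlinarith [norm_nonneg u]
  have hupn : ‖up‖ = 1 := unit_of _ (by rw [up0, up1, hst])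
  have humn : ‖um‖ = 1 := unit_of _ (by rw [um0, um1]; linarith)
  have hjip : hh Dj up = hh Di up := by have := hji up; rw [up0] at this; linarith
  have hjim : hh Dj um = hh Di um := by have := hji um; rw [um0] at this; linarith
  have maxex : ∀ u : Pt, ∃ E ∈ S, Act S E u := by
    intro u
    obtain ⟨E, hE, h⟩ := hfin.exists_maximalFor (fun E => hh E u) S ⟨Di, hi⟩
    exact ⟨E, hE, fun F hF => by
      rcases le_total (hh F u) (hh E u) with h' | h'
      · exact h'
      · exact h hF h'⟩
  -- the lower claim
  have hlow : ∃ D ∈ S, hh Di um < hh D um := by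
    obtain ⟨E, hE, hEA⟩ := maxex um
    by_contra hcon
    push Not at hcon
    have hAi : Act S Di um := hcon
    have hAj : Act S Dj um := fun F hF => hjim ▸ hcon F hF
    obtain ⟨D, hD, hDi, hDj⟩ := hS3
    obtain ⟨o, ho, hccw⟩ := hbetween D hD hDi hDj
    obtain ⟨m, hm⟩ := (hsc D hD).nonempty
    have h3 := (hccw _ (act_mem humn hi hri hAi) m hm _ (act_mem humn hj hrj hAj)).2.2
    have h4 := hull_le_s14 humn hAi (interior_subset ho)
    simp only [cross, hh, inner2] at h3 h4
    simp [um0, um1] at h3 h4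
    have e1 : Dj.center 0 = Di.center 0 + d := by rw [hd]; ring
    have e2 : Di.radius = Dj.radius + s * d := by linarith
    rw [e1, e2, ← hy] at h3
    rw [e2] at h4
    have k : 0 ≤ d * t * (s * Di.center 0 - t * Di.center 1 + (Dj.radius + s * d) - (s * o 0 - t * o 1)) :=
      mul_nonneg (mul_pos hd0 ht).le (by linarith)
    clear hccw hji maxex unit_of
    have hss : s ^ 2 = 1 - t ^ 2 := by linarith
    have id1 : (Di.center 0 + d + Dj.radius * s - o 0) * (Di.center 1 + -((Dj.radius + s * d) * t) - o 1) -
      (Di.center 1 + -(Dj.radius * t) - o 1) * (Di.center 0 + (Dj.radius + s * d) * s - o 0)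
      = - (d * t * (s * Di.center 0 - t * Di.center 1 + (Dj.radius + s * d) - (s * o 0 - t * o 1))) := by
      linear_combination (-d * (Di.center 1 - o 1)) * hst
    linarith
  have hnotm : ¬ Act S Di um := fun h => by
    obtain ⟨D, hD, h'⟩ := hlow
    linarith [h D hD]
  have hnotm' : ¬ Act S Dj um := fun h => by
    obtain ⟨D, hD, h'⟩ := hlow
    linarith [h D hD]
  have hcross : ∀ o a m b : Pt, ccw3 o a m b →
      0 < (b 0 - m 0) * (a 1 - m 1) - (b 1 - m 1) * (a 0 - m 0) := by
    rintro o a m b ⟨h1, h2, h3⟩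
    simp only [cross] at h1 h2 h3
    nlinarith
  -- the upper claim
  have hupA : Act S Di up := by
    by_contra hcon
    have hconj : ¬ Act S Dj up := fun h => hcon fun F hF => hjip ▸ h F hF
    obtain ⟨E, hE, hEA⟩ := maxex up
    have hEi : E ≠ Di := by rintro rfl; exact hcon hEA
    have hEj : E ≠ Dj := by rintro rfl; exact hconj hEA
    have hlt : hh Di up < hh E up := by
      by_contra hn
      push Not at hn
      exact hcon fun F hF => (hEA F hF).trans hn
    obtain ⟨o, ho, hccw⟩ := hbetween E hE hEi hEj
    obtain ⟨a, ha⟩ := (hsc Di hi).nonempty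
    obtain ⟨b, hb⟩ := (hsc Dj hj).nonempty
    have hm := act_mem hupn hE (hr E hE) hEA
    have hc := hcross _ _ _ _ (hccw a ha _ hm b hb)
    obtain ⟨ua, hua, hAa, hae⟩ := arc_dir hfin hr hi ha
    obtain ⟨ub, hub, hAb, hbe⟩ := arc_dir hfin hr hj hb
    set m := E.center + E.radius • up with hmdef
    have hapts : a ∈ Di.pts := by rw [hae]; exact tp_mem hua hri
    have hbpts : b ∈ Dj.pts := by rw [hbe]; exact tp_mem hub hrj
    have hmpts : m ∈ E.pts := tp_mem hupn (hr E hE)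
    have hia : ⟪ua, a⟫ = hh Di ua := by rw [hae]; exact inner_tp hua
    have hib : ⟪ub, b⟫ = hh Dj ub := by rw [hbe]; exact inner_tp hub
    have him : ⟪up, m⟫ = hh E up := inner_tp hupn
    have hua2 : ua 0 ^ 2 + ua 1 ^ 2 = 1 := by rw [← normsq2, hua]; norm_num
    have hub2 : ub 0 ^ 2 + ub 1 ^ 2 = 1 := by rw [← normsq2, hub]; norm_num
    have heq : ∀ u : Pt, u 0 ^ 2 + u 1 ^ 2 = 1 → u 0 = s → u = up ∨ u = um := by
      intro u h h0
      have : (u 1 - t) * (u 1 + t) = 0 := by rw [h0] at h; linarith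
      rcases mul_eq_zero.1 this with h' | h'
      · left; exact ext2 (by rw [h0, up0]) (by rw [up1]; linarith)
      · right; exact ext2 (by rw [h0, um0]) (by rw [um1]; linarith)
    have hua0 : ua 0 < s := by
      have h1 := hAa Dj hj
      have h2 := hji ua
      have h3 : ua 0 ≤ s := by
        by_contra hn; push Not at hn; linarith [mul_pos (sub_pos.2 hn) hd0]
      rcases h3.eq_or_lt with h | h
      · rcases heq ua hua2 h with h | h
        · exact absurd (h ▸ hAa) hcon
        · exact absurd (h ▸ hAa) hnotm
      · exact h
    have hub0 : s < ub 0 := by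
      have h1 := hAb Di hi
      have h2 := hji ub
      have h3 : s ≤ ub 0 := by
        by_contra hn; push Not at hn; linarith [mul_pos (sub_pos.2 hn) hd0]
      rcases h3.eq_or_lt with h | h
      · rcases heq ub hub2 h.symm with h | h
        · exact absurd (h ▸ hAb) hconj
        · exact absurd (h ▸ hAb) hnotm'
      · exact h
    have g1 := le_hh hupn hapts
    have g2 := le_hh hupn hbpts
    have g3 := (le_hh hua hbpts).trans (hAa Dj hj)
    have g4 := (le_hh hua hmpts).trans (hAa E hE)
    have g5 := (le_hh hub hapts).trans (hAb Di hi)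
    have g6 := (le_hh hub hmpts).trans (hAb E hE)
    rw [← hia] at g3 g4
    rw [← hib] at g5 g6
    have g1' : ⟪up, a⟫ < ⟪up, m⟫ := by linarith
    have g2' : ⟪up, b⟫ < ⟪up, m⟫ := by linarith
    simp only [inner2, up0, up1] at g1' g2' g3 g4 g5 g6
    clear_value m
    refine order_contra (q := -(s * (b 0 - m 0) + t * (b 1 - m 1)))
      (p := -(s * (a 0 - m 0) + t * (a 1 - m 1)))
      (β := ub 0 * (b 0 - m 0) + ub 1 * (b 1 - m 1))
      (β' := ub 0 * (a 0 - m 0) + ub 1 * (a 1 - m 1))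
      (α := ua 0 * (a 0 - m 0) + ua 1 * (a 1 - m 1))
      (α' := ua 0 * (b 0 - m 0) + ua 1 * (b 1 - m 1))
      hc ?_ ?_ ?_ ?_ ?_ ?_ ?_ ?_ ?_ (two_of_three_pos ht hst hua2 hub2 hub0 hua0)
    · ring
    · ring
    · ring
    all_goals linarith
  have hupAj : Act S Dj up := fun F hF => hjip ▸ hupA F hF
  refine ⟨⟨Di.center + Di.radius • up, Dj.center + Dj.radius • up, up, hh Di up,
    act_mem hupn hi hri hupA, act_mem hupn hj hrj hupAj, ?_, by rw [up1]; exact ht,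
    inner_tp hupn, by rw [inner_tp hupn, hjip], fun z hz => le_hh hupn hz,
    fun z hz => hjip ▸ le_hh hupn hz⟩, ?_⟩
  · intro z hz
    have hzc : z ∈ diskHull S := (convex_convexHull ℝ (diskUnion S)).segment_subset
      (pts_sub_hull hi (tp_mem hupn hri)) (pts_sub_hull hj (tp_mem hupn hrj)) hz
    refine frontier_of_max hupn hupA hzc ?_
    obtain ⟨α, β, -, -, hαβ, rfl⟩ := hz
    rw [inner_add_right, inner_smul_right, inner_smul_right, inner_tp hupn, inner_tp hupn, hjip,
      ← add_mul, hαβ, one_mul]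
  intro u' c' hu1 hle1 hle2 hex1 hex2
  have hu'n : 0 < ‖u'‖ := norm_pos_iff.2 (by rintro rfl; simp at hu1)
  set n := ‖u'‖ with hn
  have hn2 : n ^ 2 = u' 0 ^ 2 + u' 1 ^ 2 := normsq2 u'
  have hcv : ∀ D : Disk, 0 ≤ D.radius → (∀ z ∈ D.pts, ⟪u', z⟫ ≤ c') →
      (∃ z ∈ D.pts, ⟪u', z⟫ = c') → c' = ⟪u', D.center⟫ + D.radius * n := by
    rintro D hDr h1 ⟨z, hz, h2⟩
    apply le_antisymm
    · rw [← h2]; exact inner_le_of_pts hz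
    · have h3 := h1 (D.center + D.radius • (n⁻¹ • u')) (tp_mem (by
        rw [norm_smul, norm_inv, Real.norm_of_nonneg hu'n.le, ← hn]; field_simp) hDr)
      rw [inner_add_right, inner_smul_right, inner_smul_right, real_inner_self_eq_norm_sq,
        ← hn] at h3
      have : n⁻¹ * n ^ 2 = n := by field_simp
      rwa [this] at h3
  have c1 := hcv Di hri hle1 hex1
  have c2 := hcv Dj hrj hle2 hex2
  have hu0 : u' 0 = n * s := by
    rw [c1] at c2
    simp only [inner2, hy] at c2
    have : (u' 0 - n * s) * d = 0 := by rw [sub_mul, mul_assoc, hs, hd]; linarith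
    rcases mul_eq_zero.1 this with h | h
    · linarith
    · exact absurd h hd0.ne'
  have hu1' : u' 1 = n * (-t) := by
    have : (u' 1 + n * t) * (u' 1 - n * t) = 0 := by
      rw [hu0] at hn2
      linear_combination (-n ^ 2) * hst - hn2
    rcases mul_eq_zero.1 this with h | h
    · linarith
    · linarith [mul_pos hu'n ht]
  have hu' : u' = n • um := ext2 (by simp [um0, hu0]) (by simp [um1, hu1'])
  obtain ⟨D, hD, hDlow⟩ := hlow
  have hDi : D ≠ Di := by rintro rfl; exact lt_irrefl _ hDlow
  have hDj : D ≠ Dj := by rintro rfl; rw [hjim] at hDlow; exact lt_irrefl _ hDlow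
  have hDup : hh D up < hh Di up := by
    refine lt_of_le_of_ne (hupA D hD) fun he => ?_
    have hDA : Act S D up := fun F hF => he ▸ hupA F hF
    obtain ⟨o, ho, hccw⟩ := hbetween D hD hDi hDj
    have hc := hcross _ _ _ _ (hccw _ (act_mem hupn hi hri hupA) _ (act_mem hupn hD (hr D hD) hDA)
      _ (act_mem hupn hj hrj hupAj))
    have ea := inner_tp (D := Di) hupn
    have em := inner_tp (D := D) hupn
    have eb := inner_tp (D := Dj) hupn
    rw [he] at em
    rw [hjip] at eb
    generalize Di.center + Di.radius • up = a at *
    generalize D.center + D.radius • up = m at *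
    generalize Dj.center + Dj.radius • up = b at *
    rw [inner2, up0, up1] at ea em eb
    have k1 : t * ((b 0 - m 0) * (a 1 - m 1) - (b 1 - m 1) * (a 0 - m 0)) = 0 := by
      linear_combination (b 0 - m 0) * (ea - em) - (a 0 - m 0) * (eb - em)
    linarith [mul_pos ht hc]
  refine ⟨D, hD, hDi, hDj, ⟨D.center + D.radius • um, tp_mem humn (hr D hD), ?_⟩, ?_, ?_⟩
  · rw [c1, hu', real_inner_smul_left, real_inner_smul_left, inner_tp humn]
    have : n * hh Di um < n * hh D um := mul_lt_mul_of_pos_left hDlow hu'n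
    simp only [hh] at this ⊢
    linarith
  · have hTf : ({D, Di, Dj} : Set Disk).Finite := by simp
    have hTr : ∀ E ∈ ({D, Di, Dj} : Set Disk), 0 ≤ E.radius := by
      rintro E (rfl | rfl | rfl)
      · exact hr _ hD
      · exact hri
      · exact hrj
    rintro E (rfl | rfl | rfl)
    · exact arc3_conn hTf hTr (B := Di) (C := Dj) (fun E => by simp) hupn humn hDup.le
        (by rw [hjip]; exact hDup) hDlow.le (by rw [hjim]; exact hDlow.le)
    · exact arc3_conn hTf hTr (B := Dj) (C := D) (fun E => by simp; tauto) humn hupn hjim.ge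
        hDlow hjip.le hDup.le
    · exact arc3_conn hTf hTr (B := Di) (C := D) (fun E => by simp; tauto) humn hupn hjim.le
        (by rw [hjim]; exact hDlow) hjip.ge (by rw [hjip]; exact hDup.le)
  · have hsub : ∀ E ∈ ({D, Di, Dj} : Set Disk), E ∈ S := by
      rintro E (rfl | rfl | rfl) <;> assumption
    intro A hA B hB
    exact hind A (hsub A hA) B (hsub B hB)
end
end
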